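/- arXiv:2011.11468 — 2 statements merged into one kernel-verified Lean document; each statement's English description precedes it below -/
import Mathlib

section
/- There exists p₀ such that for every α > 1/8, every prime p ≥ p₀(α), and every set A ⊆ ZMod p with |A| ≥ α·p, one has A(A+A) ⊇ (ZMod p) \ {0}; that is, every nonzero residue x ∈ ZMod p can be written as x = a·(b+c) with a, b, c ∈ A. (Formally: for every α > 1/8 there exists p₀ such that for all primes p ≥ p₀ and all A ⊆ ZMod p with |A| ≥ α·p, every nonzero x ∈ ZMod p lies in {a*(b+c) : a,b,c ∈ A}.) -/
open Finset
open scoped Classical Pointwise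

namespace AAA

/-- Number of representations of `x` as a sum of an element of `A` and one of `B`. -/
noncomputable def rep {p : ℕ} (A B : Finset (ZMod p)) (x : ZMod p) : ℕ :=
  (B.filter (fun b => x - b ∈ A)).card

lemma rep_le {p : ℕ} (A B : Finset (ZMod p)) (x : ZMod p) : rep A B x ≤ B.card :=
  card_filter_le _ _

lemma rep_comm {p : ℕ} (A B : Finset (ZMod p)) (x : ZMod p) : rep A B x = rep B A x := by
  unfold rep
  refine card_bij' (fun b _ => x - b) (fun b _ => x - b) ?_ ?_ ?_ ?_ <;> simp +contextual

lemma rep_union_right {p : ℕ} (A B C : Finset (ZMod p)) (h : Disjoint B C) (x : ZMod p) :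
    rep A (B ∪ C) x = rep A B x + rep A C x := by
  unfold rep
  rw [filter_union, card_union_of_disjoint (disjoint_filter_filter h)]

lemma rep_union_left {p : ℕ} (A B C : Finset (ZMod p)) (h : Disjoint A B) (x : ZMod p) :
    rep (A ∪ B) C x = rep A C x + rep B C x := by
  rw [rep_comm, rep_union_right _ _ _ h, rep_comm C A, rep_comm C B]

lemma rep_split {p : ℕ} (A B : Finset (ZMod p)) (x : ZMod p) :
    rep A B x = rep (A ∪ B) (A ∩ B) x + rep (A \ B) (B \ A) x := by
  have hA : A = (A \ B) ∪ (A ∩ B) := by grind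
  have hB : B = (B \ A) ∪ (A ∩ B) := by grind
  have hU : A ∪ B = ((A \ B) ∪ (A ∩ B)) ∪ (B \ A) := by grind
  have d1 : Disjoint (A \ B) (A ∩ B) := by
    rw [disjoint_left]; grind
  have d2 : Disjoint (B \ A) (A ∩ B) := by
    rw [disjoint_left]; grind
  have d3 : Disjoint ((A \ B) ∪ (A ∩ B)) (B \ A) := by
    rw [disjoint_left]; grind
  rw [hU, rep_union_left _ _ _ d3, rep_union_left _ _ _ d1]
  have hrep : rep A B x = rep ((A \ B) ∪ (A ∩ B)) ((B \ A) ∪ (A ∩ B)) x := by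
    rw [← hA, ← hB]
  rw [hrep, rep_union_right _ _ _ d2, rep_union_left _ _ _ d1, rep_union_left _ _ _ d1,
    rep_comm (A ∩ B) (B \ A)]
  ring

lemma sum_rep {p : ℕ} [NeZero p] (A B : Finset (ZMod p)) :
    ∑ x, rep A B x = A.card * B.card := by
  unfold rep
  simp_rw [card_filter]
  rw [sum_comm]
  have : ∀ b ∈ B, ∑ x, (if x - b ∈ A then 1 else 0) = A.card := by
    intro b _
    rw [← Equiv.sum_comp (Equiv.addRight b)]
    simp
  rw [sum_congr rfl this]
  simp [mul_comm]

lemma exists_shift {p : ℕ} [Fact p.Prime] (A B : Finset (ZMod p)) (hA : A.Nonempty)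
    (hA' : A ≠ univ) (hB : 2 ≤ B.card) :
    ∃ g : ZMod p, (A ∩ B.image (· + g)).Nonempty ∧ ¬ (B.image (· + g) ⊆ A) := by
  by_contra! hcon
  obtain ⟨b₁, h₁, b₂, h₂, hne⟩ := one_lt_card.mp hB
  have key : ∀ y ∈ A, y + (b₂ - b₁) ∈ A := by
    intro y hy
    have := hcon (y - b₁) ⟨y, by simp only [mem_inter, mem_image]; exact ⟨hy, b₁, h₁, by ring⟩⟩
    apply this
    simp only [mem_image]
    exact ⟨b₂, h₂, by ring⟩
  obtain ⟨y, hy⟩ := hA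
  have key2 : ∀ n : ℕ, y + n * (b₂ - b₁) ∈ A := by
    intro n
    induction n with
    | zero => simpa using hy
    | succ n ih =>
      have := key _ ih
      convert this using 1
      push_cast; ring
  apply hA'
  ext z
  simp only [mem_univ, iff_true]
  have hd : b₂ - b₁ ≠ 0 := sub_ne_zero.mpr hne.symm
  have := key2 ((z - y) / (b₂ - b₁)).val
  rw [ZMod.natCast_zmod_val, div_mul_cancel₀ _ hd] at this
  simpa using this

lemma pollard {p : ℕ} [Fact p.Prime] (n : ℕ) : ∀ (t : ℕ) (A B : Finset (ZMod p)), B.card = n →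
    t ≤ A.card → t ≤ B.card →
    t * min p (A.card + B.card - t) ≤ ∑ x, min t (rep A B x) := by
  induction n using Nat.strong_induction_on with
  | _ n ih =>
  intro t A B hn htA htB
  rcases Nat.eq_zero_or_pos t with rfl | htpos
  · simp
  rcases htB.eq_or_lt with heq | hlt
  · have : ∀ x, min t (rep A B x) = rep A B x := fun x => min_eq_right (heq ▸ rep_le A B x)
    simp_rw [this]
    rw [sum_rep, ← heq, mul_comm A.card]
    gcongr
    omega
  by_cases hAu : A = univ
  · have : ∀ x, min t (rep A B x) = t := by
      intro x
      apply min_eq_left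
      unfold rep
      simp [hAu, htB]
    simp_rw [this]
    simp only [sum_const, card_univ, ZMod.card, smul_eq_mul]
    rw [mul_comm]
    gcongr
    omega
  obtain ⟨g, hg1, hg2⟩ := exists_shift A B (card_pos.mp (by omega)) hAu (by omega)
  set C := B.image (· + g) with hC
  have hCc : C.card = B.card := card_image_of_injective _ (add_left_injective g)
  have hsum : ∑ x, min t (rep A B x) = ∑ x, min t (rep A C x) := by
    rw [← Equiv.sum_comp (Equiv.addRight g) (fun x => min t (rep A C x))]
    refine sum_congr rfl fun x _ => ?_
    congr 1
    unfold rep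
    rw [hC, filter_image, card_image_of_injective _ (add_left_injective g)]
    simp
  rw [hsum, ← hCc]
  have hI : (A ∩ C).card < C.card := by
    apply card_lt_card
    rw [ssubset_iff_subset_ne]
    refine ⟨inter_subset_right, fun h => hg2 ?_⟩
    rw [← h]; exact inter_subset_left
  have hIpos : 0 < (A ∩ C).card := card_pos.mpr hg1
  have hUI : (A ∪ C).card + (A ∩ C).card = A.card + C.card := card_union_add_card_inter A C
  have hAC : (A \ C).card + (A ∩ C).card = A.card := card_sdiff_add_card_inter A C
  have hCA : (C \ A).card + (A ∩ C).card = C.card := by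
    rw [inter_comm]; exact card_sdiff_add_card_inter C A
  have hUp : (A ∪ C).card ≤ p := by
    have := card_le_univ (A ∪ C)
    rwa [ZMod.card] at this
  by_cases hti : t ≤ (A ∩ C).card
  · have h1 := ih (A ∩ C).card (by omega) t (A ∪ C) (A ∩ C) rfl (by omega) hti
    rw [hUI] at h1
    refine h1.trans (sum_le_sum fun x _ => ?_)
    rw [rep_split A C]
    omega
  · push Not at hti
    have h1 := ih (C \ A).card (by omega) (t - (A ∩ C).card) (A \ C) (C \ A) rfl
      (by omega) (by omega)
    have h2 : ∑ x, rep (A ∪ C) (A ∩ C) x + ∑ x, min (t - (A ∩ C).card) (rep (A \ C) (C \ A) x)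
        ≤ ∑ x, min t (rep A C x) := by
      rw [← sum_add_distrib]
      refine sum_le_sum fun x _ => ?_
      rw [rep_split A C]
      have := rep_le (A ∪ C) (A ∩ C) x
      omega
    refine le_trans ?_ h2
    rw [sum_rep]
    refine le_trans ?_ (Nat.add_le_add_left h1 _)
    refine (Nat.mul_le_mul_left t (min_le_right _ _)).trans ?_
    rw [min_eq_right (by omega)]
    obtain ⟨s, hs⟩ := Nat.exists_eq_add_of_lt hti
    have e1 : t - (A ∩ C).card = s + 1 := by omega
    rw [e1]
    obtain ⟨w, hw⟩ : ∃ w, A.card + C.card = t + w := ⟨A.card + C.card - t, by omega⟩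
    have e2 : A.card + C.card - t = w := by omega
    rw [e2]
    have e3 : (A \ C).card + (C \ A).card - (s + 1) + (A ∩ C).card = w := by omega
    have e4 : (A ∪ C).card = w + (s + 1) := by omega
    rw [e4, hs]
    generalize (A \ C).card + (C \ A).card - (s + 1) = u at *
    generalize (A ∩ C).card = i at *
    subst e3
    nlinarith

end AAA

namespace AAA

/-- The standard additive character. -/
noncomputable def e {p : ℕ} [Fact p.Prime] (x : ZMod p) : ℂ := ZMod.stdAddChar x

section
variable {p : ℕ} [Fact p.Prime]

lemma e_add (x y : ZMod p) : e (x + y) = e x * e y := AddChar.map_add_eq_mul _ _ _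

lemma e_zero : e (0 : ZMod p) = 1 := AddChar.map_zero_eq_one _

lemma norm_e (x : ZMod p) : ‖e x‖ = 1 := by
  unfold e
  exact Circle.norm_coe _

lemma conj_e (x : ZMod p) : (starRingEnd ℂ) (e x) = e (-x) := by
  have h : e x * e (-x) = 1 := by rw [← e_add]; simp [e_zero]
  have h2 : (starRingEnd ℂ) (e x) * e x = 1 := by
    rw [mul_comm, Complex.mul_conj, Complex.normSq_eq_norm_sq, norm_e]; simp
  calc (starRingEnd ℂ) (e x) = (starRingEnd ℂ) (e x) * (e x * e (-x)) := by rw [h, mul_one]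
    _ = e (-x) := by rw [← mul_assoc, h2, one_mul]

lemma sum_e (u : ZMod p) : ∑ m : ZMod p, e (m * u) = if u = 0 then (p : ℂ) else 0 := by
  unfold e
  have := AddChar.sum_mulShift u (ZMod.isPrimitive_stdAddChar p)
  rw [ZMod.card] at this
  exact_mod_cast this

lemma parseval2 {X : Type*} [Fintype X] (u v : X → ZMod p) :
    ∑ m : ZMod p, ∑ n : ZMod p, ‖∑ x, e (m * u x + n * v x)‖ ^ 2 =
      (p : ℝ) ^ 2 * (univ.filter (fun q : X × X => u q.1 = u q.2 ∧ v q.1 = v q.2)).card := by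
  have h : (∑ m : ZMod p, ∑ n : ZMod p, ((‖∑ x, e (m * u x + n * v x)‖ ^ 2 : ℝ) : ℂ)) =
      (p : ℂ) ^ 2 * (univ.filter (fun q : X × X => u q.1 = u q.2 ∧ v q.1 = v q.2)).card := by
    have h1 : ∀ m n : ZMod p, ((‖∑ x, e (m * u x + n * v x)‖ ^ 2 : ℝ) : ℂ) =
        ∑ q : X × X, e (m * (u q.1 - u q.2)) * e (n * (v q.1 - v q.2)) := by
      intro m n
      rw [← Complex.normSq_eq_norm_sq, ← Complex.mul_conj, map_sum, sum_mul_sum,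
        ← univ_product_univ, sum_product]
      refine sum_congr rfl fun x _ => sum_congr rfl fun y _ => ?_
      rw [conj_e, ← e_add, ← e_add]
      congr 1; ring
    simp_rw [h1]
    have h2 : ∀ m : ZMod p, ∑ n : ZMod p, ∑ q : X × X,
        e (m * (u q.1 - u q.2)) * e (n * (v q.1 - v q.2)) =
        ∑ q : X × X, e (m * (u q.1 - u q.2)) * (if v q.1 - v q.2 = 0 then (p : ℂ) else 0) := by
      intro m
      rw [sum_comm]
      refine sum_congr rfl fun q _ => ?_
      rw [← mul_sum, sum_e]
    simp_rw [h2]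
    rw [sum_comm]
    simp_rw [← sum_mul, sum_e]
    rw [card_filter]
    push_cast
    rw [mul_sum]
    refine sum_congr rfl fun q _ => ?_
    by_cases h3 : u q.1 = u q.2 <;> by_cases h4 : v q.1 = v q.2 <;>
      simp [h3, h4, sub_eq_zero, sq]
  exact_mod_cast h

/-- Kloosterman sum (with `0⁻¹ = 0`). -/
noncomputable def K (r s : ZMod p) : ℂ := ∑ a : ZMod p, e (r * a + s * a⁻¹)

lemma K_scale (r s t : ZMod p) (ht : t ≠ 0) : K (r * t) (s * t⁻¹) = K r s := by
  unfold K
  rw [← Equiv.sum_comp (Equiv.mulLeft₀ t ht) (fun a => e (r * a + s * a⁻¹))]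
  refine sum_congr rfl fun a _ => ?_
  rw [show (Equiv.mulLeft₀ t ht) a = t * a from rfl, mul_inv]
  congr 1; ring

lemma energy_bound :
    ((univ.filter (fun q : (ZMod p × ZMod p) × (ZMod p × ZMod p) =>
      q.1.1 + q.1.2 = q.2.1 + q.2.2 ∧
      q.1.1⁻¹ + q.1.2⁻¹ = q.2.1⁻¹ + q.2.2⁻¹)).card) ≤ 7 * p ^ 2 := by
  let F : Fin 7 → (ZMod p × ZMod p) → (ZMod p × ZMod p) × (ZMod p × ZMod p) :=
    ![fun y => ((0, y.1), (y.2, y.1 - y.2)), fun y => ((y.1, 0), (y.2, y.1 - y.2)),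
      fun y => ((y.1, -y.1), (y.2, -y.2)), fun y => ((y.1, y.2), (0, y.1 + y.2)),
      fun y => ((y.1, y.2), (y.1 + y.2, 0)), fun y => ((y.1, y.2), (y.1, y.2)),
      fun y => ((y.1, y.2), (y.2, y.1))]
  have hsub : (univ.filter (fun q : (ZMod p × ZMod p) × (ZMod p × ZMod p) =>
      q.1.1 + q.1.2 = q.2.1 + q.2.2 ∧
      q.1.1⁻¹ + q.1.2⁻¹ = q.2.1⁻¹ + q.2.2⁻¹)) ⊆ univ.biUnion (fun i => univ.image (F i)) := by
    rintro ⟨⟨a, b⟩, ⟨c, d⟩⟩ hq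
    simp only [mem_filter, mem_univ, true_and] at hq
    obtain ⟨h1, h2⟩ := hq
    simp only [mem_biUnion, mem_univ, true_and, mem_image]
    by_cases ha : a = 0
    · exact ⟨0, (b, c), by simp [F, ha]; rw [ha] at h1; linear_combination h1⟩
    by_cases hb : b = 0
    · exact ⟨1, (a, c), by simp [F, hb]; rw [hb] at h1; linear_combination h1⟩
    by_cases hab : a + b = 0
    · refine ⟨2, (a, c), ?_⟩
      simp [F]
      exact ⟨by linear_combination -hab, by linear_combination h1 - hab⟩
    by_cases hc : c = 0
    · exact ⟨3, (a, b), by simp [F, hc]; rw [hc] at h1; linear_combination h1⟩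
    by_cases hd : d = 0
    · exact ⟨4, (a, b), by simp [F, hd]; rw [hd] at h1; linear_combination h1⟩
    have h3 : (a + b) * (c * d - a * b) = 0 := by
      field_simp at h2
      linear_combination h2 - a * b * h1
    have h4 : c * d - a * b = 0 := (mul_eq_zero.mp h3).resolve_left hab
    have h5 : (c - a) * (c - b) = 0 := by
      have : d = a + b - c := by linear_combination -h1
      rw [this] at h4
      linear_combination -h4
    rcases mul_eq_zero.mp h5 with h | h
    · have : c = a := by linear_combination h
      subst this
      exact ⟨5, (c, b), by simp [F]; linear_combination h1⟩
    · have : c = b := by linear_combination h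
      subst this
      exact ⟨6, (a, c), by simp [F]; linear_combination h1⟩
  refine (card_le_card hsub).trans (card_biUnion_le.trans ?_)
  refine (sum_le_card_nsmul _ _ (p ^ 2) fun i _ => ?_).trans (by simp)
  refine card_image_le.trans ?_
  simp [ZMod.card, sq]

lemma K_bound (r s : ZMod p) (hr : r ≠ 0) : ‖K r s‖ ^ 4 ≤ 14 * (p : ℝ) ^ 3 := by
  have hp2 : (2 : ℝ) ≤ p := by exact_mod_cast (Fact.out : p.Prime).two_le
  have hsq : ∀ m n : ZMod p, ‖∑ x : ZMod p × ZMod p,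
      e (m * (x.1 + x.2) + n * (x.1⁻¹ + x.2⁻¹))‖ ^ 2 = ‖K m n‖ ^ 4 := by
    intro m n
    have : ∑ x : ZMod p × ZMod p, e (m * (x.1 + x.2) + n * (x.1⁻¹ + x.2⁻¹)) = K m n ^ 2 := by
      unfold K
      rw [sq, sum_mul_sum, ← univ_product_univ, sum_product]
      refine sum_congr rfl fun x _ => sum_congr rfl fun y _ => ?_
      rw [← e_add]; congr 1; ring
    rw [this, norm_pow]; ring
  have h := parseval2 (p := p) (fun x : ZMod p × ZMod p => x.1 + x.2)
    (fun x => x.1⁻¹ + x.2⁻¹)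
  simp_rw [hsq] at h
  have hE := energy_bound (p := p)
  have hlow : ((p : ℝ) - 1) * ‖K r s‖ ^ 4 ≤ ∑ m : ZMod p, ∑ n : ZMod p, ‖K m n‖ ^ 4 := by
    have h1 : ∑ t ∈ (univ.erase (0 : ZMod p)), ‖K (r * t) (s * t⁻¹)‖ ^ 4
        = ((p : ℝ) - 1) * ‖K r s‖ ^ 4 := by
      rw [sum_congr rfl (fun t ht => by rw [K_scale r s t (ne_of_mem_erase ht)]), sum_const,
        card_erase_of_mem (mem_univ _), card_univ, ZMod.card, nsmul_eq_mul,
        Nat.cast_sub (Fact.out : p.Prime).one_le]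
      simp
    rw [← h1]
    calc ∑ t ∈ (univ.erase (0 : ZMod p)), ‖K (r * t) (s * t⁻¹)‖ ^ 4
        ≤ ∑ t : ZMod p, ‖K (r * t) (s * t⁻¹)‖ ^ 4 :=
          sum_le_sum_of_subset_of_nonneg (subset_univ _) (fun _ _ _ => by positivity)
      _ ≤ ∑ t : ZMod p, ∑ n : ZMod p, ‖K (r * t) n‖ ^ 4 := by
          refine sum_le_sum fun t _ => ?_
          exact single_le_sum (f := fun n => ‖K (r * t) n‖ ^ 4) (fun _ _ => by positivity)
            (mem_univ _)
      _ = _ := Equiv.sum_comp (Equiv.mulLeft₀ r hr) (fun m => ∑ n : ZMod p, ‖K m n‖ ^ 4)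
  rw [h] at hlow
  have hE' : ((univ.filter (fun q : (ZMod p × ZMod p) × (ZMod p × ZMod p) =>
      q.1.1 + q.1.2 = q.2.1 + q.2.2 ∧
      q.1.1⁻¹ + q.1.2⁻¹ = q.2.1⁻¹ + q.2.2⁻¹)).card : ℝ) ≤ 7 * (p : ℝ) ^ 2 := by
    exact_mod_cast hE
  have h3 := hlow.trans (mul_le_mul_of_nonneg_left hE' (by positivity : (0:ℝ) ≤ (p:ℝ)^2))
  have h4 : (p : ℝ) / 2 * ‖K r s‖ ^ 4 ≤ ((p : ℝ) - 1) * ‖K r s‖ ^ 4 := by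
    gcongr; linarith
  have h5 : (p : ℝ) / 2 * ‖K r s‖ ^ 4 ≤ (p : ℝ) / 2 * (14 * (p : ℝ) ^ 3) := by
    refine (h4.trans h3).trans (le_of_eq ?_); ring
  exact le_of_mul_le_mul_left h5 (by positivity)

/-- Deviation bound for all frequency pairs. -/
lemma K_dev (r s : ZMod p) :
    ‖K r s - (p : ℂ)⁻¹ * ((∑ a : ZMod p, e (r * a)) * ∑ a : ZMod p, e (s * a))‖
      ≤ 2 * (p : ℝ) ^ (3 / 4 : ℝ) := by
  have hp0 : (p : ℂ) ≠ 0 := by exact_mod_cast (Fact.out : p.Prime).ne_zero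
  have hsum : ∀ r : ZMod p, ∑ a : ZMod p, e (r * a) = if r = 0 then (p : ℂ) else 0 := by
    intro r; simp_rw [mul_comm r]; exact sum_e r
  rw [hsum, hsum]
  have hnn : 0 ≤ 2 * (p : ℝ) ^ (3 / 4 : ℝ) := by positivity
  by_cases hr : r = 0
  · have h0 : K 0 s = if s = 0 then (p : ℂ) else 0 := by
      unfold K
      rw [← hsum s, ← Equiv.sum_comp (Equiv.inv (ZMod p)) (fun a => e (s * a))]
      simp
    subst hr
    rw [h0]
    by_cases hs : s = 0
    · simp [hs, hp0]; positivity
    · simp [hs]; positivity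
  · by_cases hs : s = 0
    · subst hs
      have h0 : K r 0 = 0 := by
        unfold K
        have := hsum r
        rw [if_neg hr] at this
        simpa using this
      rw [h0]; simp [hr]; positivity
    · simp only [hr, hs, if_false, mul_zero, sub_zero]
      have := K_bound r s hr
      refine le_of_pow_le_pow_left₀ (n := 4) (by norm_num) hnn (this.trans ?_)
      rw [mul_pow, ← Real.rpow_natCast ((p : ℝ) ^ (3 / 4 : ℝ)), ← Real.rpow_mul (by positivity)]
      norm_num
      rw [← Real.rpow_natCast]
      have : (0:ℝ) ≤ (p : ℝ) ^ (3:ℝ) := by positivity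
      push_cast
      linarith
end
end AAA

namespace AAA
section
variable {p : ℕ} [Fact p.Prime]

/-- `f` is a combination of characters with coefficient sum at most `W`. -/
def Wie (f : ZMod p → ℂ) (W : ℝ) : Prop :=
  ∃ (ι : Type) (_ : Fintype ι) (c : ι → ℂ) (r : ι → ZMod p),
    (∀ x, f x = ∑ i, c i * e (r i * x)) ∧ ∑ i, ‖c i‖ ≤ W

lemma Wie.one : Wie (fun _ : ZMod p => (1 : ℂ)) 1 :=
  ⟨Unit, inferInstance, fun _ => 1, fun _ => 0, by simp [e_zero], by simp⟩

lemma Wie.nonneg {f : ZMod p → ℂ} {W : ℝ} (h : Wie f W) : 0 ≤ W := by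
  obtain ⟨ι, _, c, r, -, h2⟩ := h
  exact (sum_nonneg fun _ _ => norm_nonneg _).trans h2

lemma Wie.mul {f g : ZMod p → ℂ} {W V : ℝ} (hf : Wie f W) (hg : Wie g V) :
    Wie (fun x => f x * g x) (W * V) := by
  have hW := hf.nonneg
  obtain ⟨ι, _, c, r, h1, h2⟩ := hf
  obtain ⟨κ, _, d, s, h3, h4⟩ := hg
  refine ⟨ι × κ, inferInstance, fun q => c q.1 * d q.2, fun q => r q.1 + s q.2, ?_, ?_⟩
  · intro x
    beta_reduce
    rw [h1, h3, sum_mul_sum, ← univ_product_univ, sum_product]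
    refine sum_congr rfl fun i _ => sum_congr rfl fun j _ => ?_
    rw [add_mul, e_add]; ring
  · rw [← univ_product_univ, sum_product]
    simp_rw [norm_mul]
    rw [← sum_mul_sum]
    exact mul_le_mul h2 h4 (sum_nonneg fun _ _ => norm_nonneg _) hW

lemma Wie.const_mul {f : ZMod p → ℂ} {W : ℝ} (hf : Wie f W) (z : ℂ) (hz : ‖z‖ ≤ 1) :
    Wie (fun x => z * f x) W := by
  obtain ⟨ι, _, c, r, h1, h2⟩ := hf
  refine ⟨ι, inferInstance, fun i => z * c i, r, ?_, ?_⟩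
  · intro x
    beta_reduce
    rw [h1, mul_sum]
    exact sum_congr rfl fun i _ => by ring
  · refine (sum_le_sum fun i _ => ?_).trans h2
    rw [norm_mul]
    exact mul_le_of_le_one_left (norm_nonneg _) hz

lemma Wie.sum {κ : Type} [Fintype κ] {f : κ → ZMod p → ℂ} {W : ℝ} (hf : ∀ k, Wie (f k) W) :
    Wie (fun x => ∑ k, f k x) (Fintype.card κ * W) := by
  choose ι hι c r h1 h2 using hf
  refine ⟨Σ k, ι k, inferInstance, fun q => c q.1 q.2, fun q => r q.1 q.2, ?_, ?_⟩
  · intro x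
    rw [Fintype.sum_sigma]
    exact sum_congr rfl fun k _ => h1 k x
  · rw [Fintype.sum_sigma]
    refine (sum_le_sum fun k _ => h2 k).trans ?_
    simp

lemma Wie.dilate {f : ZMod p → ℂ} {W : ℝ} (hf : Wie f W) (t : ZMod p) :
    Wie (fun x => f (t * x)) W := by
  obtain ⟨ι, _, c, r, h1, h2⟩ := hf
  refine ⟨ι, inferInstance, c, fun i => r i * t, ?_, h2⟩
  intro x
  beta_reduce
  rw [h1]
  exact sum_congr rfl fun i _ => by rw [mul_assoc]

lemma Wie.prod {W : ℝ} (k : ℕ) : ∀ {f : Fin k → ZMod p → ℂ}, (∀ i, Wie (f i) W) →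
    Wie (fun x => ∏ i, f i x) (W ^ k) := by
  induction k with
  | zero => intro f _; simpa using Wie.one
  | succ k ih =>
    intro f hf
    simp_rw [Fin.prod_univ_succ, pow_succ']
    exact (hf 0).mul (ih fun i => hf i.succ)

lemma Wie.equi {f g : ZMod p → ℂ} {W V : ℝ} (hf : Wie f W) (hg : Wie g V) :
    ‖∑ a, f a * g a⁻¹ - (p : ℂ)⁻¹ * ((∑ a, f a) * ∑ a, g a)‖ ≤
      W * V * (2 * (p : ℝ) ^ (3 / 4 : ℝ)) := by
  have hW := hf.nonneg
  obtain ⟨ι, _, c, r, h1, h2⟩ := hf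
  obtain ⟨κ, _, d, s, h3, h4⟩ := hg
  have hf1 : ∑ a, f a = ∑ i, c i * ∑ a, e (r i * a) := by
    simp_rw [h1, mul_sum]; exact sum_comm
  have hg1 : ∑ a, g a = ∑ i, d i * ∑ a, e (s i * a) := by
    simp_rw [h3, mul_sum]; exact sum_comm
  have hfg : ∑ a, f a * g a⁻¹ = ∑ i, ∑ j, c i * d j * K (r i) (s j) := by
    simp_rw [h1, h3, sum_mul_sum]
    rw [sum_comm]
    refine sum_congr rfl fun i _ => ?_
    rw [sum_comm]
    refine sum_congr rfl fun j _ => ?_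
    unfold K
    rw [mul_sum]
    refine sum_congr rfl fun a _ => ?_
    rw [e_add]; ring
  have key : ∑ a, f a * g a⁻¹ - (p : ℂ)⁻¹ * ((∑ a, f a) * ∑ a, g a) =
      ∑ i, ∑ j, c i * d j * (K (r i) (s j) -
        (p : ℂ)⁻¹ * ((∑ a : ZMod p, e (r i * a)) * ∑ a : ZMod p, e (s j * a))) := by
    rw [hfg, hf1, hg1, sum_mul_sum, mul_sum, ← sum_sub_distrib]
    refine sum_congr rfl fun i _ => ?_
    rw [mul_sum, ← sum_sub_distrib]
    refine sum_congr rfl fun j _ => ?_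
    ring
  rw [key]
  calc _ ≤ ∑ i, ∑ j, ‖c i‖ * ‖d j‖ * (2 * (p : ℝ) ^ (3 / 4 : ℝ)) := by
        refine (norm_sum_le _ _).trans (sum_le_sum fun i _ => ?_)
        refine (norm_sum_le _ _).trans (sum_le_sum fun j _ => ?_)
        rw [norm_mul, norm_mul]
        exact mul_le_mul_of_nonneg_left (K_dev _ _) (by positivity)
    _ = (∑ i, ‖c i‖) * (∑ j, ‖d j‖) * (2 * (p : ℝ) ^ (3 / 4 : ℝ)) := by
        rw [sum_mul_sum, sum_mul]
        exact sum_congr rfl fun i _ => by rw [sum_mul]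
    _ ≤ _ := by
        refine mul_le_mul_of_nonneg_right ?_ (by positivity)
        exact mul_le_mul h2 h4 (sum_nonneg fun _ _ => norm_nonneg _) hW

lemma sum_zmod_val (F : ℕ → ℝ) : ∑ r : ZMod p, F r.val = ∑ v ∈ range p, F v := by
  refine sum_bij' (fun r _ => r.val) (fun v _ => (v : ZMod p)) ?_ ?_ ?_ ?_ ?_
  · intro r _; exact mem_range.mpr (ZMod.val_lt r)
  · intro _ _; exact mem_univ _
  · intro r _; simp
  · intro v hv; exact ZMod.val_cast_of_lt (mem_range.mp hv)
  · intro _ _; rfl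

lemma norm_one_sub_e (r : ZMod p) (hr : r ≠ 0) :
    2 * (‖1 - e r‖)⁻¹ ≤ (p : ℝ) * (1 / 2 * ((r.val : ℝ)⁻¹ + ((p : ℝ) - r.val)⁻¹)) := by
  have hp : (0 : ℝ) < p := by exact_mod_cast (Fact.out : p.Prime).pos
  have hv : (r.val : ℝ) < p := by exact_mod_cast ZMod.val_lt r
  have hv0 : (0 : ℝ) < r.val := by
    have : r.val ≠ 0 := by rwa [Ne, ZMod.val_eq_zero]
    exact_mod_cast Nat.pos_of_ne_zero this
  have he : ‖1 - e r‖ = ‖2 * Real.sin (Real.pi * r.val / p)‖ := by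
    have : e r = Complex.exp (Complex.I * ((2 * Real.pi * r.val / p : ℝ) : ℂ)) := by
      unfold e
      conv_lhs => rw [show r = (((r.val : ℤ)) : ZMod p) by simp]
      rw [ZMod.stdAddChar_coe]
      congr 1; push_cast; ring
    rw [norm_sub_rev, this, Complex.norm_exp_I_mul_ofReal_sub_one]
    congr 3; ring
  rw [he, norm_mul, Real.norm_ofNat, Real.norm_eq_abs]
  set v : ℝ := (r.val : ℝ)
  have hpi := Real.pi_pos
  have hd : (0 : ℝ) < p - v := by linarith
  have hs : ∃ m, 0 < m ∧ 2 * m / p ≤ |Real.sin (Real.pi * v / p)| ∧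
      m⁻¹ ≤ v⁻¹ + ((p : ℝ) - v)⁻¹ := by
    by_cases h : v ≤ p / 2
    · refine ⟨v, hv0, ?_, by simp [hd.le]⟩
      have := Real.mul_le_sin (x := Real.pi * v / p) (by positivity)
        (by rw [div_le_iff₀ hp]; nlinarith)
      refine le_trans (le_of_eq ?_) (this.trans (le_abs_self _))
      field_simp
    · refine ⟨p - v, hd, ?_, by simp [hv0.le]⟩
      have := Real.mul_le_sin (x := Real.pi * (p - v) / p) (by positivity)
        (by rw [div_le_iff₀ hp]; nlinarith)
      have h2 : Real.pi * (p - v) / p = Real.pi - Real.pi * v / p := by field_simp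
      rw [h2, Real.sin_pi_sub] at this
      refine le_trans (le_of_eq ?_) (this.trans (le_abs_self _))
      field_simp
  obtain ⟨m, hm, h1, h2⟩ := hs
  have h3 : (0:ℝ) < 2 * m / p := by positivity
  calc 2 * (2 * |Real.sin (Real.pi * v / p)|)⁻¹ ≤ 2 * (2 * (2 * m / p))⁻¹ := by gcongr
    _ = p * (1 / 2 * m⁻¹) := by field_simp
    _ ≤ _ := by gcongr

lemma Wie.interval (a b : ℕ) (hab : a ≤ b) (hb : b ≤ p) :
    Wie (fun y : ZMod p => if y.val ∈ Ico a b then (1 : ℂ) else 0) (2 + Real.log p) := by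
  have hp : (0 : ℝ) < p := by exact_mod_cast (Fact.out : p.Prime).pos
  have hp0 : (p : ℂ) ≠ 0 := by exact_mod_cast (Fact.out : p.Prime).ne_zero
  refine ⟨ZMod p, inferInstance, fun r => (p : ℂ)⁻¹ * ∑ n ∈ Ico a b, e (r * (-(n : ZMod p))),
    fun r => r, ?_, ?_⟩
  · intro x
    have : ∑ r : ZMod p, (p : ℂ)⁻¹ * (∑ n ∈ Ico a b, e (r * (-(n : ZMod p)))) * e (r * x) =
        ∑ n ∈ Ico a b, if x = (n : ZMod p) then (1 : ℂ) else 0 := by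
      simp_rw [mul_sum, sum_mul]
      rw [sum_comm]
      refine sum_congr rfl fun n _ => ?_
      have h1 : ∀ r : ZMod p, (p : ℂ)⁻¹ * e (r * (-(n : ZMod p))) * e (r * x) =
          (p : ℂ)⁻¹ * e (r * (x - (n : ZMod p))) := by
        intro r
        rw [mul_assoc, ← e_add]; congr 2; ring
      simp_rw [h1]
      rw [← mul_sum, sum_e]
      by_cases h : x = n
      · simp [h, hp0]
      · simp [h, sub_eq_zero]
    rw [this]
    have h2 : ∀ n ∈ Ico a b, (if x = (n : ZMod p) then (1 : ℂ) else 0) =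
        if x.val = n then 1 else 0 := by
      intro n hn
      have hn' : n < p := (mem_Ico.mp hn).2.trans_le hb
      congr 1
      apply propext
      constructor
      · intro h; rw [h]; exact ZMod.val_cast_of_lt hn'
      · intro h; rw [← h]; simp
    rw [sum_congr rfl h2, sum_ite_eq]
  · have hc : ∀ r : ZMod p, ‖(p : ℂ)⁻¹ * ∑ n ∈ Ico a b, e (r * (-(n : ZMod p)))‖ ≤
        (if r = 0 then 1 else 0) + 1 / 2 * (((-r).val : ℝ)⁻¹ + ((p : ℝ) - (-r).val)⁻¹) := by
      intro r
      rw [norm_mul, norm_inv, Complex.norm_natCast]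
      by_cases hr : r = 0
      · have h1 : ‖∑ n ∈ Ico a b, e (r * (-(n : ZMod p)))‖ ≤ p := by
          refine (norm_sum_le _ _).trans ?_
          simp_rw [norm_e]
          simp only [sum_const, Nat.card_Ico, nsmul_eq_mul, mul_one]
          exact_mod_cast (by omega : b - a ≤ p)
        have h2 : (p : ℝ)⁻¹ * ‖∑ n ∈ Ico a b, e (r * (-(n : ZMod p)))‖ ≤ 1 := by
          rw [inv_mul_le_iff₀ hp]; linarith
        have h3 : (0:ℝ) ≤ 1 / 2 * (((-r).val : ℝ)⁻¹ + ((p : ℝ) - (-r).val)⁻¹) := by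
          have : ((-r).val : ℝ) < p := by exact_mod_cast ZMod.val_lt (-r)
          have : (0 : ℝ) < p - ((-r).val : ℝ) := by linarith
          positivity
        rw [if_pos hr]; linarith
      · rw [if_neg hr, zero_add, inv_mul_le_iff₀ hp]
        refine le_trans ?_ (norm_one_sub_e (-r) (neg_ne_zero.mpr hr))
        have hpow : ∀ n : ℕ, e (r * (-(n : ZMod p))) = e (-r) ^ n := by
          intro n
          unfold e
          rw [← AddChar.map_nsmul_eq_pow]; congr 1; simp; ring
        simp_rw [hpow]
        have hg := geom_sum_Ico_mul_neg (e (-r)) hab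
        have hne : ‖1 - e (-r)‖ ≠ 0 := by
          rw [norm_ne_zero_iff, sub_ne_zero]
          intro h
          have h2 : e (-r) = e (0 : ZMod p) := by rw [e_zero, ← h]
          exact hr (neg_eq_zero.mp (ZMod.injective_stdAddChar h2))
        have hle : ‖∑ i ∈ Ico a b, e (-r) ^ i‖ * ‖1 - e (-r)‖ ≤ 2 := by
          rw [← norm_mul, hg]
          refine (norm_sub_le _ _).trans ?_
          rw [norm_pow, norm_pow, norm_e]; norm_num
        rw [← div_eq_mul_inv, le_div_iff₀ (lt_of_le_of_ne (norm_nonneg _) hne.symm)]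
        exact hle
    refine (sum_le_sum fun r _ => hc r).trans ?_
    rw [sum_add_distrib, sum_ite_eq' univ (0 : ZMod p), if_pos (mem_univ _)]
    have hneg := Equiv.sum_comp (Equiv.neg (ZMod p))
      (fun r => 1 / 2 * ((r.val : ℝ)⁻¹ + ((p : ℝ) - r.val)⁻¹))
    simp only [Equiv.neg_apply] at hneg
    rw [hneg, sum_zmod_val (fun v => 1 / 2 * ((v : ℝ)⁻¹ + ((p : ℝ) - v)⁻¹)), ← mul_sum, sum_add_distrib]
    have hH : ∑ v ∈ range p, ((p : ℝ) - v)⁻¹ = harmonic p := by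
      rw [← sum_range_reflect]
      unfold harmonic
      push_cast
      refine sum_congr rfl fun j hj => ?_
      have hj' := mem_range.mp hj
      rw [Nat.cast_sub (by omega), Nat.cast_sub (by omega)]
      congr 1; push_cast; ring
    have hH2 : ∑ v ∈ range p, (v : ℝ)⁻¹ ≤ harmonic p := by
      unfold harmonic
      push_cast
      have h1 : ∑ v ∈ range (p + 1), (v : ℝ)⁻¹ = ∑ v ∈ range p, ((v : ℝ) + 1)⁻¹ := by
        rw [sum_range_succ']; simp
      rw [← h1, sum_range_succ]
      have : (0:ℝ) ≤ (p : ℝ)⁻¹ := by positivity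
      linarith
    have := harmonic_le_one_add_log p
    linarith

/-- Bucket index of a residue. -/
def bucket (N : ℕ) (y : ZMod p) : ℕ := N * y.val / p

lemma bucket_lt {N : ℕ} (hN : 0 < N) (y : ZMod p) : bucket N y < N := by
  unfold bucket
  have hp := (Fact.out : p.Prime).pos
  rw [Nat.div_lt_iff_lt_mul hp]
  exact Nat.mul_lt_mul_of_pos_left (ZMod.val_lt y) hN

lemma Wie.bucket {N : ℕ} (hN : 0 < N) (j : ℕ) (hj : j < N) :
    Wie (fun y : ZMod p => if bucket N y = j then (1 : ℂ) else 0) (2 + Real.log p) := by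
  have hp := (Fact.out : p.Prime).pos
  have h1 : (j * p) ⌈/⌉ N ≤ ((j + 1) * p) ⌈/⌉ N := by
    rw [ceilDiv_le_iff_le_mul hN]
    have := (ceilDiv_le_iff_le_mul (b := (j+1) * p) (c := ((j + 1) * p) ⌈/⌉ N) hN).mp le_rfl
    nlinarith
  have h2 : ((j + 1) * p) ⌈/⌉ N ≤ p := by
    rw [ceilDiv_le_iff_le_mul hN]
    exact Nat.mul_le_mul_right p hj
  convert Wie.interval (p := p) _ _ h1 h2 using 2 with y
  congr 1
  apply propext
  rw [mem_Ico, ceilDiv_le_iff_le_mul hN, ← not_le, ceilDiv_le_iff_le_mul hN, not_le]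
  unfold AAA.bucket
  rw [Nat.div_eq_iff hp]
  constructor
  · rintro ⟨h3, h4⟩
    refine ⟨by nlinarith, ?_⟩
    have : j * p + p = (j + 1) * p := by ring
    omega
  · rintro ⟨h3, h4⟩
    refine ⟨by nlinarith, ?_⟩
    have : j * p + p = (j + 1) * p := by ring
    omega

/-- Measurability with respect to the cells defined by the frequencies `ξ`. -/
def Meas {α : Type*} (N : ℕ) {k : ℕ} (ξ : Fin k → ZMod p) (F : ZMod p → α) : Prop :=
  ∀ x y, (∀ i, bucket N (ξ i * x) = bucket N (ξ i * y)) → F x = F y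

lemma Wie.meas {N : ℕ} (hN : 0 < N) {k : ℕ} (ξ : Fin k → ZMod p) (F : ZMod p → ℂ)
    (hF : Meas N ξ F) (hb : ∀ x, ‖F x‖ ≤ 1) : Wie F ((N * (2 + Real.log p)) ^ k) := by
  let G : (Fin k → Fin N) → ℂ := fun v =>
    if h : ∃ y, ∀ i, AAA.bucket N (ξ i * y) = v i then F h.choose else 0
  have hG : ∀ v, ‖G v‖ ≤ 1 := by
    intro v
    by_cases h : ∃ y, ∀ i, AAA.bucket N (ξ i * y) = v i
    · simp only [G, dif_pos h]; exact hb _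
    · simp only [G, dif_neg h]; simp
  have hrep : F = fun x => ∑ v : Fin k → Fin N, G v * ∏ i, (fun (i : Fin k) (x : ZMod p) =>
      if AAA.bucket N (ξ i * x) = (v i : ℕ) then (1 : ℂ) else 0) i x := by
    funext x
    let v0 : Fin k → Fin N := fun i => ⟨AAA.bucket N (ξ i * x), bucket_lt hN _⟩
    rw [sum_eq_single v0]
    · have h : ∃ y, ∀ i, AAA.bucket N (ξ i * y) = v0 i := ⟨x, fun i => rfl⟩
      have : G v0 = F x := by
        simp only [G, dif_pos h]
        exact hF _ _ fun i => h.choose_spec i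
      rw [this]
      simp [v0]
    · intro v _ hv
      have : ∃ i, AAA.bucket N (ξ i * x) ≠ v i := by
        by_contra! hcon
        apply hv
        funext i
        exact Fin.ext (hcon i).symm
      obtain ⟨i, hi⟩ := this
      rw [prod_eq_zero (mem_univ i) (by simp [hi]), mul_zero]
    · simp
  rw [hrep]
  have := Wie.sum (κ := Fin k → Fin N) (W := (2 + Real.log p) ^ k)
    (f := fun v x => G v * ∏ i, (fun (i : Fin k) (x : ZMod p) =>
      if AAA.bucket N (ξ i * x) = (v i : ℕ) then (1 : ℂ) else 0) i x) (fun v =>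
      (Wie.prod k fun i => (Wie.bucket hN (v i) (v i).2).dilate (ξ i)).const_mul _ (hG v))
  convert this using 1
  simp [mul_pow]

end
end AAA

namespace AAA
section
variable {p : ℕ} [Fact p.Prime]

/-- Fourier coefficient. -/
noncomputable def ft (u : ZMod p → ℝ) (r : ZMod p) : ℂ := ∑ x, (u x : ℂ) * e (r * x)

lemma ft_parseval (u : ZMod p → ℝ) : ∑ r, ‖ft u r‖ ^ 2 = p * ∑ x, u x ^ 2 := by
  have h : ∑ r, ((‖ft u r‖ ^ 2 : ℝ) : ℂ) = p * ∑ x, (u x : ℂ) ^ 2 := by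
    have h1 : ∀ r, ((‖ft u r‖ ^ 2 : ℝ) : ℂ) =
        ∑ x, ∑ y, (u x : ℂ) * u y * e (r * (x - y)) := by
      intro r
      rw [← Complex.normSq_eq_norm_sq, ← Complex.mul_conj]
      unfold ft
      rw [map_sum, sum_mul_sum]
      refine sum_congr rfl fun x _ => sum_congr rfl fun y _ => ?_
      rw [map_mul, conj_e, Complex.conj_ofReal,
        show r * (x - y) = r * x + -(r * y) by ring, e_add]
      ring
    simp_rw [h1]
    rw [sum_comm, mul_sum]
    refine sum_congr rfl fun x _ => ?_
    rw [sum_comm]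
    simp_rw [← mul_sum, sum_e, sub_eq_zero]
    simp
    ring
  exact_mod_cast h

/-- Trilinear form. -/
noncomputable def T (u v w : ZMod p → ℝ) : ℝ := ∑ b, ∑ c, u b * v c * w (b + c)

lemma T_fourier (u v w : ZMod p → ℝ) :
    (p : ℂ) * (T u v w : ℂ) = ∑ r, ft u r * ft v r * (starRingEnd ℂ) (ft w r) := by
  have h1 : ∀ r, ft u r * ft v r * (starRingEnd ℂ) (ft w r) =
      ∑ b, ∑ c, ∑ d, (u b : ℂ) * v c * w d * e (r * (b + c - d)) := by
    intro r
    unfold ft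
    rw [map_sum, sum_mul_sum, sum_mul]
    refine sum_congr rfl fun b _ => ?_
    rw [sum_mul_sum]
    refine sum_congr rfl fun c _ => sum_congr rfl fun d _ => ?_
    rw [map_mul, conj_e, Complex.conj_ofReal,
      show r * (b + c - d) = r * b + r * c + -(r * d) by ring, e_add, e_add]
    ring
  simp_rw [h1]
  rw [sum_comm]
  unfold T
  push_cast
  rw [mul_sum]
  refine sum_congr rfl fun b _ => ?_
  rw [sum_comm, mul_sum]
  refine sum_congr rfl fun c _ => ?_
  rw [sum_comm]
  simp_rw [← mul_sum, sum_e, sub_eq_zero]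
  simp
  ring

lemma l2_le (u : ZMod p → ℝ) (hu : ∀ x, |u x| ≤ 1) : ∑ x, u x ^ 2 ≤ p := by
  calc ∑ x, u x ^ 2 ≤ ∑ _x : ZMod p, (1 : ℝ) :=
        sum_le_sum fun x _ => by
          rw [← sq_abs]; exact pow_le_one₀ (abs_nonneg _) (hu x)
    _ = p := by simp [ZMod.card]

lemma T_bound_aux (u v w : ZMod p → ℝ) (a b : ZMod p → ℝ) (D : ℝ) (hD : 0 ≤ D)
    (ha : ∀ x, |a x| ≤ 1) (hb : ∀ x, |b x| ≤ 1)
    (h : ∀ r, ‖ft u r‖ * ‖ft v r‖ * ‖ft w r‖ ≤ D * (‖ft a r‖ * ‖ft b r‖)) :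
    |T u v w| ≤ D * p := by
  have hp : (0 : ℝ) < p := by exact_mod_cast (Fact.out : p.Prime).pos
  have h1 : (p : ℝ) * |T u v w| = ‖(p : ℂ) * (T u v w : ℂ)‖ := by
    rw [norm_mul, Complex.norm_natCast, Complex.norm_real, Real.norm_eq_abs]
  have h2 : (p : ℝ) * |T u v w| ≤ p * (D * p) := by
    rw [h1, T_fourier]
    calc _ ≤ ∑ r, D * ((‖ft a r‖ ^ 2 + ‖ft b r‖ ^ 2) / 2) := by
          refine (norm_sum_le _ _).trans (sum_le_sum fun r _ => ?_)
          rw [norm_mul, norm_mul, Complex.norm_conj]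
          refine (h r).trans (mul_le_mul_of_nonneg_left ?_ hD)
          nlinarith [sq_nonneg (‖ft a r‖ - ‖ft b r‖)]
      _ = D * ((p * ∑ x, a x ^ 2 + p * ∑ x, b x ^ 2) / 2) := by
          rw [← mul_sum, ← sum_div, sum_add_distrib, ft_parseval, ft_parseval]
      _ ≤ D * ((p * p + p * p) / 2) := by
          have := l2_le a ha
          have := l2_le b hb
          gcongr
      _ = _ := by ring
  exact le_of_mul_le_mul_left h2 hp

lemma T_bound1 (u v w : ZMod p → ℝ) (D : ℝ) (hD : 0 ≤ D) (hu : ∀ r, ‖ft u r‖ ≤ D)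
    (hv : ∀ x, |v x| ≤ 1) (hw : ∀ x, |w x| ≤ 1) : |T u v w| ≤ D * p := by
  refine T_bound_aux u v w v w D hD hv hw fun r => ?_
  rw [mul_assoc]
  exact mul_le_mul_of_nonneg_right (hu r) (by positivity)

lemma T_bound2 (u v w : ZMod p → ℝ) (D : ℝ) (hD : 0 ≤ D) (hv : ∀ r, ‖ft v r‖ ≤ D)
    (hu : ∀ x, |u x| ≤ 1) (hw : ∀ x, |w x| ≤ 1) : |T u v w| ≤ D * p := by
  refine T_bound_aux u v w u w D hD hu hw fun r => ?_
  rw [mul_comm ‖ft u r‖, mul_assoc]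
  exact mul_le_mul_of_nonneg_right (hv r) (by positivity)

lemma T_bound3 (u v w : ZMod p → ℝ) (D : ℝ) (hD : 0 ≤ D) (hw : ∀ r, ‖ft w r‖ ≤ D)
    (hu : ∀ x, |u x| ≤ 1) (hv : ∀ x, |v x| ≤ 1) : |T u v w| ≤ D * p := by
  refine T_bound_aux u v w u v D hD hu hv fun r => ?_
  rw [mul_comm]
  exact mul_le_mul_of_nonneg_right (hw r) (by positivity)

lemma T_compare (u f w g : ZMod p → ℝ) (D : ℝ) (hD : 0 ≤ D)
    (h1 : ∀ r, ‖ft (fun x => u x - f x) r‖ ≤ D) (h2 : ∀ r, ‖ft (fun x => w x - g x) r‖ ≤ D)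
    (hu : ∀ x, |u x| ≤ 1) (hf : ∀ x, |f x| ≤ 1) (hw : ∀ x, |w x| ≤ 1) :
    T f f g ≤ T u u w + 3 * D * p := by
  have e1 : T u u w = T (fun x => u x - f x) u w + T f (fun x => u x - f x) w +
      T f f (fun x => w x - g x) + T f f g := by
    unfold T
    simp_rw [← sum_add_distrib]
    refine sum_congr rfl fun b _ => sum_congr rfl fun c _ => ?_
    ring
  have b1 := T_bound1 _ u w D hD h1 hu hw
  have b2 := T_bound2 f _ w D hD h1 hf hw
  have b3 := T_bound3 f f _ D hD h2 hf hf
  rw [abs_le] at b1 b2 b3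
  linarith [b1.1, b2.1, b3.1]

/-- The cell of `x`. -/
noncomputable def cell (N : ℕ) {k : ℕ} (ξ : Fin k → ZMod p) (x : ZMod p) : Finset (ZMod p) :=
  univ.filter (fun y => ∀ i, bucket N (ξ i * y) = bucket N (ξ i * x))

/-- Conditional expectation on cells. -/
noncomputable def cond (N : ℕ) {k : ℕ} (ξ : Fin k → ZMod p) (u : ZMod p → ℝ) (x : ZMod p) : ℝ :=
  (∑ y ∈ cell N ξ x, u y) / (cell N ξ x).card

lemma mem_cell {N : ℕ} {k : ℕ} {ξ : Fin k → ZMod p} {x y : ZMod p} :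
    y ∈ cell N ξ x ↔ ∀ i, bucket N (ξ i * y) = bucket N (ξ i * x) := by
  simp [cell]

lemma cell_congr {N : ℕ} {k : ℕ} {ξ : Fin k → ZMod p} {x y : ZMod p}
    (h : ∀ i, bucket N (ξ i * x) = bucket N (ξ i * y)) : cell N ξ x = cell N ξ y := by
  ext z; rw [mem_cell, mem_cell]; simp_rw [h]

lemma cell_pos {N : ℕ} {k : ℕ} {ξ : Fin k → ZMod p} (x : ZMod p) : 0 < (cell N ξ x).card :=
  card_pos.mpr ⟨x, mem_cell.mpr fun _ => rfl⟩

lemma cond_meas (N : ℕ) {k : ℕ} (ξ : Fin k → ZMod p) (u : ZMod p → ℝ) :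
    Meas N ξ (cond N ξ u) := by
  intro x y h
  unfold cond
  rw [cell_congr h]

lemma cond_nonneg (N : ℕ) {k : ℕ} (ξ : Fin k → ZMod p) (u : ZMod p → ℝ) (hu : ∀ x, 0 ≤ u x)
    (x : ZMod p) : 0 ≤ cond N ξ u x :=
  div_nonneg (sum_nonneg fun y _ => hu y) (by positivity)

lemma cond_le_one (N : ℕ) {k : ℕ} (ξ : Fin k → ZMod p) (u : ZMod p → ℝ) (hu : ∀ x, u x ≤ 1)
    (x : ZMod p) : cond N ξ u x ≤ 1 := by
  unfold cond
  have : (0 : ℝ) < (cell N ξ x).card := by exact_mod_cast cell_pos x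
  rw [div_le_one this]
  refine (sum_le_sum fun y _ => hu y).trans ?_
  simp

lemma cond_sum (N : ℕ) {k : ℕ} (ξ : Fin k → ZMod p) (u : ZMod p → ℝ) (φ : ZMod p → ℂ)
    (hφ : Meas N ξ φ) : ∑ x, (cond N ξ u x : ℂ) * φ x = ∑ x, (u x : ℂ) * φ x := by
  have h1 : ∀ x, (cond N ξ u x : ℂ) * φ x = ∑ y, (if y ∈ cell N ξ x then
      (u y : ℂ) * φ y / (cell N ξ y).card else 0) := by
    intro x
    unfold cond
    rw [← sum_filter, filter_mem_eq_inter, univ_inter]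
    push_cast
    rw [sum_div, sum_mul]
    refine sum_congr rfl fun y hy => ?_
    have hy' := mem_cell.mp hy
    rw [cell_congr hy', hφ y x hy']
    ring
  simp_rw [h1]
  rw [sum_comm]
  refine sum_congr rfl fun y _ => ?_
  have h2 : ∀ x, (y ∈ cell N ξ x) ↔ x ∈ cell N ξ y := by
    intro x
    rw [mem_cell, mem_cell]
    exact forall_congr' fun i => eq_comm
  simp_rw [h2]
  rw [← sum_filter, filter_mem_eq_inter, univ_inter, sum_const, nsmul_eq_mul]
  have : ((cell N ξ y).card : ℂ) ≠ 0 := by exact_mod_cast (cell_pos y).ne'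
  field_simp

lemma cond_sum_real (N : ℕ) {k : ℕ} (ξ : Fin k → ZMod p) (u : ZMod p → ℝ) (φ : ZMod p → ℝ)
    (hφ : Meas N ξ φ) : ∑ x, cond N ξ u x * φ x = ∑ x, u x * φ x := by
  have := cond_sum N ξ u (fun x => (φ x : ℂ)) (fun x y h => by beta_reduce; rw [hφ x y h])
  exact_mod_cast this

lemma meas_cons {α : Type*} (N : ℕ) {k : ℕ} (ξ : Fin k → ZMod p) (r : ZMod p) (F : ZMod p → α)
    (h : Meas N ξ F) : Meas N (Fin.cons r ξ : Fin (k + 1) → ZMod p) F := by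
  intro x y hxy
  exact h x y fun i => by simpa using hxy i.succ

lemma e_bucket {N : ℕ} (hN : 0 < N) (y : ZMod p) :
    ‖e y - Complex.exp (Complex.I * ((2 * Real.pi * bucket N y / N : ℝ) : ℂ))‖
      ≤ 2 * Real.pi / N := by
  have hp : (0 : ℝ) < p := by exact_mod_cast (Fact.out : p.Prime).pos
  have hN' : (0 : ℝ) < N := by exact_mod_cast hN
  have he : e y = Complex.exp (Complex.I * ((2 * Real.pi * y.val / p : ℝ) : ℂ)) := by
    unfold e
    conv_lhs => rw [show y = (((y.val : ℤ)) : ZMod p) by simp]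
    rw [ZMod.stdAddChar_coe]
    congr 1; push_cast; ring
  set A : ℝ := 2 * Real.pi * y.val / p with hA
  set B : ℝ := 2 * Real.pi * bucket N y / N with hB
  have hsplit : Complex.exp (Complex.I * (A : ℂ)) - Complex.exp (Complex.I * (B : ℂ)) =
      Complex.exp (Complex.I * (B : ℂ)) * (Complex.exp (Complex.I * ((A - B : ℝ) : ℂ)) - 1) := by
    rw [mul_sub, ← Complex.exp_add, mul_one]
    congr 2; push_cast; ring
  rw [he, hsplit, norm_mul, Complex.norm_exp_I_mul_ofReal, one_mul,
    Complex.norm_exp_I_mul_ofReal_sub_one, norm_mul, Real.norm_ofNat, Real.norm_eq_abs]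
  have hsin : |Real.sin ((A - B) / 2)| ≤ |(A - B) / 2| := Real.abs_sin_le_abs
  have hb1 : bucket N y * p ≤ N * y.val := Nat.div_mul_le_self _ _
  have hb2 : N * y.val < (bucket N y + 1) * p := by
    unfold bucket
    have := Nat.lt_div_mul_add (a := N * y.val) (Fact.out : p.Prime).pos
    rw [add_mul, one_mul]; exact this
  have hb1' : (bucket N y : ℝ) * p ≤ N * y.val := by exact_mod_cast hb1
  have hb2' : (N : ℝ) * y.val ≤ (bucket N y + 1) * p := by exact_mod_cast hb2.le
  have hq1 : (bucket N y : ℝ) / N ≤ y.val / p := by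
    rw [div_le_div_iff₀ hN' hp]; linarith
  have hq2 : (y.val : ℝ) / p ≤ (bucket N y + 1) / N := by
    rw [div_le_div_iff₀ hp hN']; linarith
  have hAB : A - B = 2 * Real.pi * (y.val / p - bucket N y / N) := by
    rw [hA, hB]; ring
  have hpi := Real.pi_pos
  have h0 : 0 ≤ A - B := by
    rw [hAB]; exact mul_nonneg (by positivity) (by linarith)
  have h1 : A - B ≤ 2 * Real.pi / N := by
    rw [hAB, div_eq_mul_inv (2 * Real.pi)]
    refine mul_le_mul_of_nonneg_left ?_ (by positivity)
    rw [add_div, one_div] at hq2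
    linarith
  rw [abs_of_nonneg (by linarith : 0 ≤ (A - B) / 2)] at hsin
  linarith

lemma energy_step {N : ℕ} (hN : 0 < N) {δ : ℝ} (hδ : 0 < δ) (hNδ : 2 * Real.pi / N ≤ δ / 2)
    (u : ZMod p → ℝ) (hu0 : ∀ x, 0 ≤ u x) (hu1 : ∀ x, u x ≤ 1) {k : ℕ} (ξ : Fin k → ZMod p)
    (r : ZMod p) (hr : δ * p < ‖ft (fun x => u x - cond N ξ u x) r‖) :
    ∑ x, cond N ξ u x ^ 2 + (δ / 2) ^ 2 * p ≤
      ∑ x, cond N (Fin.cons r ξ : Fin (k + 1) → ZMod p) u x ^ 2 := by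
  have hp : (0 : ℝ) < p := by exact_mod_cast (Fact.out : p.Prime).pos
  set f := cond N ξ u with hf
  set g := cond N (Fin.cons r ξ : Fin (k + 1) → ZMod p) u with hg
  let φ : ZMod p → ℂ := fun x =>
    Complex.exp (Complex.I * ((2 * Real.pi * bucket N (r * x) / N : ℝ) : ℂ))
  have hφn : ∀ x, ‖φ x‖ = 1 := fun x => Complex.norm_exp_I_mul_ofReal _
  have hφm : Meas N (Fin.cons r ξ : Fin (k + 1) → ZMod p) φ := by
    intro x y h
    have := h 0
    simp only [Fin.cons_zero] at this
    simp only [φ, this]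
  have hfm : Meas N (Fin.cons r ξ : Fin (k + 1) → ZMod p) f :=
    meas_cons N ξ r f (cond_meas N ξ u)
  have hgm := cond_meas N (Fin.cons r ξ : Fin (k + 1) → ZMod p) u
  have hh : ∀ x, |u x - f x| ≤ 1 := by
    intro x
    have h1 := cond_nonneg N ξ u hu0 x
    have h2 := cond_le_one N ξ u hu1 x
    rw [abs_le]
    constructor <;> linarith [hu0 x, hu1 x]
  have key1 : ‖ft (fun x => u x - f x) r - ∑ x, ((u x - f x : ℝ) : ℂ) * φ x‖ ≤ δ / 2 * p := by
    unfold ft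
    rw [← sum_sub_distrib]
    calc _ ≤ ∑ _x : ZMod p, δ / 2 := by
          refine (norm_sum_le _ _).trans (sum_le_sum fun x _ => ?_)
          rw [← mul_sub, norm_mul, Complex.norm_real, Real.norm_eq_abs]
          have := (e_bucket hN (r * x)).trans hNδ
          calc _ ≤ 1 * (δ / 2) := mul_le_mul (hh x) this (norm_nonneg _) zero_le_one
            _ = _ := one_mul _
      _ = _ := by simp [ZMod.card]; ring
  have key2 : δ / 2 * p ≤ ‖∑ x, ((u x - f x : ℝ) : ℂ) * φ x‖ := by
    have := norm_sub_norm_le (ft (fun x => u x - f x) r) (∑ x, ((u x - f x : ℝ) : ℂ) * φ x)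
    linarith
  have key3 : ∑ x, ((u x - f x : ℝ) : ℂ) * φ x = ∑ x, ((g x - f x : ℝ) : ℂ) * φ x := by
    push_cast
    simp_rw [sub_mul]
    rw [sum_sub_distrib, sum_sub_distrib, ← cond_sum N _ u φ hφm]
  have key4 : δ / 2 * p ≤ ∑ x, |g x - f x| := by
    rw [key3] at key2
    refine key2.trans ((norm_sum_le _ _).trans (sum_le_sum fun x _ => ?_))
    rw [norm_mul, hφn, mul_one, Complex.norm_real, Real.norm_eq_abs]
  have key5 : (δ / 2 * p) ^ 2 ≤ p * ∑ x, (g x - f x) ^ 2 := by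
    have h1 : (δ / 2 * p) ^ 2 ≤ (∑ x, |g x - f x|) ^ 2 := pow_le_pow_left₀ (by positivity) key4 2
    have h2 := sq_sum_le_card_mul_sum_sq (s := (univ : Finset (ZMod p))) (f := fun x => |g x - f x|)
    simp only [sq_abs, card_univ, ZMod.card] at h2
    exact h1.trans h2
  have key6 : (δ / 2) ^ 2 * p ≤ ∑ x, (g x - f x) ^ 2 := by
    have : (p : ℝ) * ((δ / 2) ^ 2 * p) ≤ p * ∑ x, (g x - f x) ^ 2 := by
      refine le_trans (le_of_eq ?_) key5; ring
    exact le_of_mul_le_mul_left this hp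
  have key7 : ∑ x, (g x - f x) ^ 2 = ∑ x, g x ^ 2 - ∑ x, f x ^ 2 := by
    have h1 : ∑ x, g x * f x = ∑ x, u x * f x := cond_sum_real N _ u f hfm
    have h2 : ∑ x, f x * f x = ∑ x, u x * f x := cond_sum_real N _ u f (cond_meas N ξ u)
    have h3 : ∑ x, (g x - f x) ^ 2 = ∑ x, g x ^ 2 - 2 * ∑ x, g x * f x + ∑ x, f x * f x := by
      rw [mul_sum, ← sum_sub_distrib, ← sum_add_distrib]
      exact sum_congr rfl fun x _ => by ring
    have h4 : ∑ x, f x ^ 2 = ∑ x, f x * f x := sum_congr rfl fun x _ => by ring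
    rw [h3, h4, h1, h2]; ring
  linarith

lemma regularity {N : ℕ} (hN : 0 < N) {δ : ℝ} (hδ : 0 < δ) (hNδ : 2 * Real.pi / N ≤ δ / 2)
    {M : ℕ} (hM : 1 < M * (δ / 2) ^ 2)
    (u : ZMod p → ℝ) (hu0 : ∀ x, 0 ≤ u x) (hu1 : ∀ x, u x ≤ 1) :
    ∃ k ≤ M, ∃ ξ : Fin k → ZMod p, ∀ r, ‖ft (fun x => u x - cond N ξ u x) r‖ ≤ δ * p := by
  have hp : (0 : ℝ) < p := by exact_mod_cast (Fact.out : p.Prime).pos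
  by_contra! hcon
  have h : ∀ n ≤ M, ∃ ξ : Fin n → ZMod p, n * (δ / 2) ^ 2 * p ≤ ∑ x, cond N ξ u x ^ 2 := by
    intro n
    induction n with
    | zero =>
      intro _
      refine ⟨Fin.elim0, ?_⟩
      simp only [Nat.cast_zero, zero_mul]
      exact sum_nonneg fun x _ => sq_nonneg _
    | succ n ih =>
      intro hn
      obtain ⟨ξ, hξ⟩ := ih (by omega)
      obtain ⟨r, hr⟩ := hcon n (by omega) ξ
      refine ⟨Fin.cons r ξ, ?_⟩
      have := energy_step hN hδ hNδ u hu0 hu1 ξ r hr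
      push_cast
      linarith
  obtain ⟨ξ, hξ⟩ := h M le_rfl
  have h2 := l2_le (cond N ξ u) fun x => by
    rw [abs_of_nonneg (cond_nonneg N ξ u hu0 x)]; exact cond_le_one N ξ u hu1 x
  nlinarith

end
end AAA

namespace AAA
section
variable {p : ℕ} [Fact p.Prime]

/-- Real indicator function. -/
noncomputable def ind (A : Finset (ZMod p)) (x : ZMod p) : ℝ := if x ∈ A then 1 else 0

lemma ind_nonneg (A : Finset (ZMod p)) (x : ZMod p) : 0 ≤ ind A x := by
  unfold ind; split_ifs <;> norm_num

lemma ind_le_one (A : Finset (ZMod p)) (x : ZMod p) : ind A x ≤ 1 := by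
  unfold ind; split_ifs <;> norm_num

lemma sum_ind (A : Finset (ZMod p)) : ∑ x, ind A x = A.card := by
  unfold ind; simp

/-- Cells in which `A` has density at least `η`. -/
noncomputable def dense (N : ℕ) {k : ℕ} (ξ : Fin k → ZMod p) (η : ℝ) (A : Finset (ZMod p)) :
    Finset (ZMod p) := univ.filter (fun x => η ≤ cond N ξ (ind A) x)

lemma dense_meas (N : ℕ) {k : ℕ} (ξ : Fin k → ZMod p) (η : ℝ) (A : Finset (ZMod p)) :
    Meas N ξ (fun x => x ∈ dense N ξ η A) := by
  intro x y h
  simp only [dense, mem_filter, mem_univ, true_and]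
  rw [cond_meas N ξ (ind A) x y h]

lemma card_sdiff_dense (N : ℕ) {k : ℕ} (ξ : Fin k → ZMod p) (η : ℝ) (hη : 0 ≤ η)
    (A : Finset (ZMod p)) : ((A \ dense N ξ η A).card : ℝ) ≤ η * p := by
  let φ : ZMod p → ℝ := fun x => if x ∈ dense N ξ η A then 0 else 1
  have hφ : Meas N ξ φ := by
    intro x y h
    have := dense_meas N ξ η A x y h
    simp only [φ]
    simp only [eq_iff_iff] at this
    simp only [this]
  have h := cond_sum_real N ξ (ind A) φ hφ
  have h1 : ∑ x, ind A x * φ x = (A \ dense N ξ η A).card := by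
    rw [← sum_ind]
    refine sum_congr rfl fun x _ => ?_
    by_cases h1 : x ∈ A <;> by_cases h2 : x ∈ dense N ξ η A <;> simp [ind, φ, h1, h2]
  rw [← h1, ← h]
  calc _ ≤ ∑ _x : ZMod p, η := by
        refine sum_le_sum fun x _ => ?_
        by_cases h2 : x ∈ dense N ξ η A
        · simp [φ, h2, hη]
        · simp only [φ, h2, if_false, mul_one]
          simp only [dense, mem_filter, mem_univ, true_and, not_le] at h2
          exact h2.le
    _ = _ := by simp [ZMod.card]; ring

lemma sum_rep_mem (S T' : Finset (ZMod p)) :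
    ((∑ y ∈ T', rep S S y : ℕ) : ℝ) = T (ind S) (ind S) (ind T') := by
  have h1 : ((∑ y ∈ T', rep S S y : ℕ) : ℝ) = ∑ y, ∑ b, ind S b * ind S (y - b) * ind T' y := by
    push_cast
    rw [← sum_filter_add_sum_filter_not univ (fun y => y ∈ T')
      (fun y => ∑ b, ind S b * ind S (y - b) * ind T' y)]
    have hz : ∑ y ∈ univ.filter (fun y => y ∉ T'), ∑ b, ind S b * ind S (y - b) * ind T' y = 0 := by
      refine sum_eq_zero fun y hy => sum_eq_zero fun b _ => ?_
      have : y ∉ T' := by simpa using hy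
      simp [ind, this]
    rw [hz, add_zero, filter_mem_eq_inter, univ_inter]
    refine sum_congr rfl fun y hy => ?_
    unfold rep
    rw [card_filter]
    push_cast
    rw [← sum_filter_add_sum_filter_not univ (fun b => b ∈ S)]
    have hz : ∑ b ∈ univ.filter (fun b => b ∉ S), ind S b * ind S (y - b) * ind T' y = 0 := by
      refine sum_eq_zero fun b hb => ?_
      have : b ∉ S := by simpa using hb
      simp [ind, this]
    rw [hz, add_zero, filter_mem_eq_inter, univ_inter]
    refine sum_congr rfl fun b hb => ?_
    simp [ind, hy, hb]
  rw [h1, sum_comm]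
  unfold T
  refine sum_congr rfl fun b _ => ?_
  rw [← Equiv.sum_comp (Equiv.addLeft b)]
  refine sum_congr rfl fun c _ => ?_
  simp

lemma count_equi {N : ℕ} (hN : 0 < N) {M k l : ℕ} (hk : k ≤ M) (hl : l ≤ M)
    (ξ : Fin k → ZMod p) (ζ : Fin l → ZMod p) (S T' : Finset (ZMod p))
    (hS : Meas N ξ (fun x => x ∈ S)) (hT : Meas N ζ (fun x => x ∈ T')) (x : ZMod p) (hx : x ≠ 0) :
    ((univ.filter (fun a => a ∈ S ∧ x * a⁻¹ ∈ T')).card : ℝ) ≤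
      S.card * T'.card / p +
        ((N * (2 + Real.log p)) ^ M) ^ 2 * (2 * (p : ℝ) ^ (3 / 4 : ℝ)) := by
  have hp1 : (1 : ℝ) ≤ p := by exact_mod_cast (Fact.out : p.Prime).one_le
  have hlog : 0 ≤ Real.log p := Real.log_nonneg hp1
  have hN1 : (1 : ℝ) ≤ N := by exact_mod_cast hN
  have hbase : 1 ≤ N * (2 + Real.log p) := by nlinarith
  have hw : ∀ (k : ℕ) (ξ : Fin k → ZMod p) (S : Finset (ZMod p)), Meas N ξ (fun x => x ∈ S) →
      Wie (fun x => (ind S x : ℂ)) ((N * (2 + Real.log p)) ^ k) := by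
    intro k ξ S hS
    refine Wie.meas hN ξ _ ?_ ?_
    · intro x y h
      have := hS x y h
      simp only [eq_iff_iff] at this
      simp only [ind, this]
    · intro x
      rw [Complex.norm_real, Real.norm_eq_abs, abs_of_nonneg (ind_nonneg _ _)]
      exact ind_le_one _ _
  have h := (hw k ξ S hS).equi ((hw l ζ T' hT).dilate x)
  have e1 : ∑ a, (ind S a : ℂ) * (ind T' (x * a⁻¹) : ℂ) =
      (((univ.filter (fun a => a ∈ S ∧ x * a⁻¹ ∈ T')).card : ℝ) : ℂ) := by
    rw [← sum_ind]
    push_cast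
    refine sum_congr rfl fun a _ => ?_
    by_cases h1 : a ∈ S <;> by_cases h2 : x * a⁻¹ ∈ T' <;> simp [ind, h1, h2]
  have e2 : ∑ a, (ind S a : ℂ) = S.card := by exact_mod_cast sum_ind S
  have e3 : ∑ a, (ind T' (x * a) : ℂ) = T'.card := by
    have := Equiv.sum_comp (Equiv.mulLeft₀ x hx) (fun a => (ind T' a : ℂ))
    rw [show ∑ a, (ind T' (x * a) : ℂ) = ∑ a, (ind T' a : ℂ) from this]
    exact_mod_cast sum_ind T'
  rw [e1, e2, e3] at h
  have e4 : (((univ.filter (fun a => a ∈ S ∧ x * a⁻¹ ∈ T')).card : ℝ) : ℂ) -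
      (p : ℂ)⁻¹ * ((S.card : ℂ) * T'.card) =
      (((univ.filter (fun a => a ∈ S ∧ x * a⁻¹ ∈ T')).card - S.card * T'.card / p : ℝ) : ℂ) := by
    push_cast; ring
  rw [e4, Complex.norm_real, Real.norm_eq_abs] at h
  have h2 := (le_abs_self _).trans h
  have h3 : (N * (2 + Real.log p)) ^ k * (N * (2 + Real.log p)) ^ l ≤
      ((N * (2 + Real.log p)) ^ M) ^ 2 := by
    rw [sq]
    gcongr
  have h4 := mul_le_mul_of_nonneg_right h3 (by positivity : 0 ≤ 2 * (p : ℝ) ^ (3 / 4 : ℝ))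
  linarith

lemma num_lemma (s u q η : ℝ) (hs : 0 ≤ s) (hq : 0 < q) (hη : 0 ≤ η) (hη1 : η ≤ 1)
    (h1 : u ≤ q + 3 * (η * q) - 2 * s) : s * u / q ≤ (1 / 8 + 2 * η) * q := by
  rw [div_le_iff₀ hq]
  have h3 : s * u ≤ s * (q + 3 * (η * q) - 2 * s) := mul_le_mul_of_nonneg_left h1 hs
  have h4 : s * (q + 3 * (η * q) - 2 * s) ≤ (q + 3 * (η * q)) ^ 2 / 8 := by
    nlinarith [sq_nonneg (4 * s - (q + 3 * (η * q)))]
  have h5 : (q + 3 * (η * q)) ^ 2 / 8 ≤ (1 / 8 + 2 * η) * q * q := by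
    have h6 : (q + 3 * (η * q)) ^ 2 / 8 = (1 + 3 * η) ^ 2 / 8 * (q * q) := by ring
    rw [h6, mul_assoc (1 / 8 + 2 * η)]
    refine mul_le_mul_of_nonneg_right ?_ (by positivity)
    nlinarith
  linarith

lemma main_fixed {η : ℝ} (hη : 0 < η) (hη1 : η ≤ 1) {N M : ℕ} (hN : 0 < N)
    (hNδ : 2 * Real.pi / N ≤ (η ^ 5 / 3) / 2) (hM : 1 < M * ((η ^ 5 / 3) / 2) ^ 2)
    (hp1 : 1 ≤ η * p)
    (hp2 : ((N * (2 + Real.log p)) ^ M) ^ 2 * (2 * (p : ℝ) ^ (3 / 4 : ℝ)) ≤ η * p)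
    (A : Finset (ZMod p)) (hA0 : (0 : ZMod p) ∉ A) (x : ZMod p) (hx : x ≠ 0)
    (hno : ∀ a ∈ A, ∀ b ∈ A, ∀ c ∈ A, x ≠ a * (b + c)) :
    (A.card : ℝ) ≤ (1 / 8 + 5 * η) * p := by
  have hp : (0 : ℝ) < p := by exact_mod_cast (Fact.out : p.Prime).pos
  set δ : ℝ := η ^ 5 / 3 with hδdef
  have hδ : 0 < δ := by positivity
  set B : Finset (ZMod p) := A.image (fun a => x * a⁻¹) with hB
  obtain ⟨k, hk, ξ, hξ⟩ := regularity (p := p) hN hδ hNδ hM (ind A) (ind_nonneg A) (ind_le_one A)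
  obtain ⟨l, hl, ζ, hζ⟩ := regularity (p := p) hN hδ hNδ hM (ind B) (ind_nonneg B) (ind_le_one B)
  set f := cond N ξ (ind A) with hf
  set g := cond N ζ (ind B) with hg
  set S := dense N ξ η A with hS
  set U := dense N ζ η B with hU
  have habs : ∀ (v : ZMod p → ℝ), (∀ y, 0 ≤ v y) → (∀ y, v y ≤ 1) → ∀ y, |v y| ≤ 1 := by
    intro v h0 h1 y
    rw [abs_of_nonneg (h0 y)]; exact h1 y
  have hf0 := cond_nonneg N ξ (ind A) (ind_nonneg A)
  have hg0 := cond_nonneg N ζ (ind B) (ind_nonneg B)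
  have hcmp := T_compare (ind A) f (ind B) g (δ * p) (by positivity) hξ hζ
    (habs _ (ind_nonneg A) (ind_le_one A))
    (habs _ hf0 (cond_le_one N ξ (ind A) (ind_le_one A)))
    (habs _ (ind_nonneg B) (ind_le_one B))
  have hzero : T (ind A) (ind A) (ind B) = 0 := by
    unfold T
    refine sum_eq_zero fun b _ => sum_eq_zero fun c _ => ?_
    by_cases h1 : b ∈ A
    swap
    · simp [ind, h1]
    by_cases h2 : c ∈ A
    swap
    · simp [ind, h2]
    have h3 : b + c ∉ B := by
      intro h
      obtain ⟨a, ha, hab⟩ := mem_image.mp h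
      have ha0 : a ≠ 0 := fun h => hA0 (h ▸ ha)
      apply hno a ha b h1 c h2
      rw [← hab]; field_simp
    simp [ind, h3]
  rw [hzero, zero_add] at hcmp
  have hlow : η ^ 3 * T (ind S) (ind S) (ind U) ≤ T f f g := by
    unfold T
    rw [mul_sum]
    refine sum_le_sum fun b _ => ?_
    rw [mul_sum]
    refine sum_le_sum fun c _ => ?_
    have hnn : 0 ≤ f b * f c * g (b + c) := mul_nonneg (mul_nonneg (hf0 b) (hf0 c)) (hg0 _)
    by_cases h1 : b ∈ S
    swap
    · simpa [ind, h1] using hnn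
    by_cases h2 : c ∈ S
    swap
    · simpa [ind, h2] using hnn
    by_cases h3 : b + c ∈ U
    swap
    · simpa [ind, h3] using hnn
    have g1 : η ≤ f b := by simpa [hS, dense] using h1
    have g2 : η ≤ f c := by simpa [hS, dense] using h2
    have g3 : η ≤ g (b + c) := by simpa [hU, dense] using h3
    simp only [ind, h1, h2, h3, if_true, mul_one]
    calc η ^ 3 = η * η * η := by ring
      _ ≤ _ := by
        have h5 : 0 ≤ f b := hf0 b
        have h6 : 0 ≤ f b * f c := mul_nonneg h5 (hf0 c)
        gcongr
  have hrep : ((∑ y ∈ U, rep S S y : ℕ) : ℝ) ≤ η ^ 2 * p ^ 2 := by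
    rw [sum_rep_mem]
    have h1 : η ^ 3 * T (ind S) (ind S) (ind U) ≤ η ^ 3 * (η ^ 2 * p ^ 2) := by
      refine (hlow.trans hcmp).trans (le_of_eq ?_)
      rw [hδdef]; ring
    exact le_of_mul_le_mul_left h1 (by positivity)
  -- counting `A`
  have hAS := card_sdiff_dense N ξ η hη.le A
  have hBU := card_sdiff_dense N ζ η hη.le B
  rw [← hS] at hAS
  rw [← hU] at hBU
  have hcount := count_equi hN hk hl ξ ζ S U (dense_meas N ξ η A) (dense_meas N ζ η B) x hx
  have hsub : A ⊆ (univ.filter (fun a => a ∈ S ∧ x * a⁻¹ ∈ U)) ∪ (A \ S) ∪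
      (A.filter (fun a => x * a⁻¹ ∉ U)) := by
    intro a ha
    simp only [mem_union, mem_filter, mem_univ, true_and, mem_sdiff]
    tauto
  have hBU2 : (A.filter (fun a => x * a⁻¹ ∉ U)).card ≤ (B \ U).card := by
    refine card_le_card_of_injOn (fun a => x * a⁻¹) ?_ ?_
    · intro a ha
      simp only [coe_filter, Set.mem_ofPred_eq] at ha
      simp only [coe_sdiff, Set.mem_sdiff, mem_coe]
      exact ⟨mem_image_of_mem _ ha.1, ha.2⟩
    · intro a _ b _ hab
      exact inv_injective (mul_left_cancel₀ hx hab)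
  have hcardA : (A.card : ℝ) ≤ S.card * U.card / p + 3 * (η * p) := by
    have h1 := (card_le_card hsub).trans ((card_union_le _ _).trans
      (Nat.add_le_add_right (card_union_le _ _) _))
    have h2 : (A.card : ℝ) ≤ ((univ.filter (fun a => a ∈ S ∧ x * a⁻¹ ∈ U)).card : ℝ) +
        ((A \ S).card : ℝ) + ((A.filter (fun a => x * a⁻¹ ∉ U)).card : ℝ) := by exact_mod_cast h1
    have h3 : ((A.filter (fun a => x * a⁻¹ ∉ U)).card : ℝ) ≤ ((B \ U).card : ℝ) := by
      exact_mod_cast hBU2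
    linarith
  have hcard_le : ∀ V : Finset (ZMod p), (V.card : ℝ) ≤ p := by
    intro V
    have := card_le_univ V
    rw [ZMod.card] at this
    exact_mod_cast this
  have hSp := hcard_le S
  have hUp := hcard_le U
  -- Pollard
  set t := ⌈η * p⌉₊ with ht
  have ht1 : η * p ≤ t := Nat.le_ceil _
  have ht2 : (t : ℝ) ≤ 2 * (η * p) := by
    have := (Nat.ceil_lt_add_one (by positivity : 0 ≤ η * p)).le
    linarith
  have htpos : (0 : ℝ) < t := by linarith
  by_cases hcase1 : S.card < t
  · have h1 : (S.card : ℝ) ≤ 2 * (η * p) := by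
      have : (S.card : ℝ) ≤ t := by exact_mod_cast hcase1.le
      linarith
    have h2 : (S.card : ℝ) * U.card / p ≤ 2 * (η * p) := by
      rw [div_le_iff₀ hp]
      exact mul_le_mul h1 hUp (by positivity) (by positivity)
    linarith
  push Not at hcase1
  have hpol := pollard (p := p) S.card t S S rfl hcase1 hcase1
  have hup : ∑ y, min t (rep S S y) + t * U.card ≤ ∑ y ∈ U, rep S S y + t * p := by
    rw [← sum_add_sum_compl U]
    have h1 : ∑ y ∈ U, min t (rep S S y) ≤ ∑ y ∈ U, rep S S y :=
      sum_le_sum fun y _ => min_le_right _ _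
    have h2 : ∑ y ∈ Uᶜ, min t (rep S S y) ≤ Uᶜ.card * t := by
      refine (sum_le_card_nsmul _ _ t fun y _ => min_le_left _ _).trans (by simp)
    have h3 : U.card + Uᶜ.card = p := by rw [card_add_card_compl, ZMod.card]
    have h4 : t * p = t * U.card + Uᶜ.card * t := by
      calc t * p = t * (U.card + Uᶜ.card) := by rw [h3]
        _ = _ := by ring
    omega
  have hmain : (t : ℝ) * (min p (S.card + S.card - t) : ℕ) + t * U.card ≤ η ^ 2 * p ^ 2 + t * p := by
    have : t * min p (S.card + S.card - t) + t * U.card ≤ ∑ y ∈ U, rep S S y + t * p := by omega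
    have h' : (t : ℝ) * (min p (S.card + S.card - t) : ℕ) + t * U.card ≤
        ((∑ y ∈ U, rep S S y : ℕ) : ℝ) + t * p := by exact_mod_cast this
    linarith
  have hmain2 : ((min p (S.card + S.card - t) : ℕ) : ℝ) + U.card ≤ η * p + p := by
    have h1 : η ^ 2 * (p : ℝ) ^ 2 ≤ t * (η * p) := by
      calc η ^ 2 * (p : ℝ) ^ 2 = (η * p) * (η * p) := by ring
        _ ≤ _ := by gcongr
    have h2 : (t : ℝ) * (((min p (S.card + S.card - t) : ℕ) : ℝ) + U.card) ≤
        t * (η * p + p) := by linarith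
    exact le_of_mul_le_mul_left h2 htpos
  rcases le_total p (S.card + S.card - t) with hmin | hmin
  · rw [min_eq_left hmin] at hmain2
    have h1 : (U.card : ℝ) ≤ η * p := by linarith
    have h2 : (S.card : ℝ) * U.card / p ≤ η * p := by
      rw [div_le_iff₀ hp, mul_comm (η * p)]
      exact mul_le_mul hSp h1 (by positivity) (by positivity)
    nlinarith
  · rw [min_eq_right hmin, Nat.cast_sub (by omega)] at hmain2
    push_cast at hmain2
    have h1 : (U.card : ℝ) ≤ p + 3 * (η * p) - 2 * S.card := by linarith
    have h2 := num_lemma (S.card : ℝ) U.card p η (by positivity) hp hη.le hη1 h1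
    linarith

end

lemma eventually_small (η : ℝ) (hη : 0 < η) (N M : ℕ) :
    ∃ p₀ : ℕ, ∀ p : ℕ, p₀ ≤ p →
      ((N * (2 + Real.log p)) ^ M) ^ 2 * (2 * (p : ℝ) ^ (3 / 4 : ℝ)) ≤ η * p := by
  have h1 : (fun x : ℝ => (2 + Real.log x)) =o[Filter.atTop]
      fun x => x ^ (1 / (8 * (M + 1)) : ℝ) := by
    refine Asymptotics.IsLittleO.add ?_ (isLittleO_log_rpow_atTop (by positivity))
    rw [Asymptotics.isLittleO_const_left]
    right
    exact Filter.tendsto_abs_atTop_atTop.comp (tendsto_rpow_atTop (by positivity))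
  have h2 := h1.bound one_pos
  have h3 : ∀ᶠ x : ℝ in Filter.atTop,
      ((N : ℝ) ^ M) ^ 2 * 2 / η ≤ x ^ (1 / (4 * (M + 1)) : ℝ) :=
    (tendsto_rpow_atTop (by positivity)).eventually_ge_atTop _
  have h4 := (h2.and (h3.and (Filter.eventually_ge_atTop (1 : ℝ))))
  have h5 := tendsto_natCast_atTop_atTop (R := ℝ) |>.eventually h4
  obtain ⟨p₀, hp₀⟩ := Filter.eventually_atTop.mp h5
  refine ⟨p₀, fun p hp => ?_⟩
  obtain ⟨g1, g2, g3⟩ := hp₀ p hp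
  set q : ℝ := (p : ℝ)
  have hq : 0 < q := by linarith
  have hlog : 0 ≤ Real.log q := Real.log_nonneg g3
  rw [Real.norm_of_nonneg (by positivity), Real.norm_of_nonneg (by positivity), one_mul] at g1
  rw [div_le_iff₀ hη] at g2
  calc ((N * (2 + Real.log q)) ^ M) ^ 2 * (2 * q ^ (3 / 4 : ℝ))
      ≤ ((N * q ^ (1 / (8 * (M + 1)) : ℝ)) ^ M) ^ 2 * (2 * q ^ (3 / 4 : ℝ)) := by gcongr
    _ = ((N : ℝ) ^ M) ^ 2 * 2 * (q ^ ((1 / (8 * (M + 1)) : ℝ) * (2 * M)) * q ^ (3 / 4 : ℝ)) := by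
        rw [Real.rpow_mul hq.le, show (2 * (M : ℝ)) = ((M * 2 : ℕ) : ℝ) by push_cast; ring,
          Real.rpow_natCast, pow_mul]
        ring
    _ ≤ (q ^ (1 / (4 * (M + 1)) : ℝ) * η) *
        (q ^ ((1 / (8 * (M + 1)) : ℝ) * (2 * M)) * q ^ (3 / 4 : ℝ)) := by gcongr
    _ = η * (q ^ (1 / (4 * (M + 1)) : ℝ) *
        (q ^ ((1 / (8 * (M + 1)) : ℝ) * (2 * M)) * q ^ (3 / 4 : ℝ))) := by ring
    _ = η * q := by
        rw [← Real.rpow_add hq, ← Real.rpow_add hq]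
        have : (1 / (4 * (M + 1)) : ℝ) + ((1 / (8 * (M + 1)) : ℝ) * (2 * M) + 3 / 4) = 1 := by
          field_simp
          ring
        rw [this, Real.rpow_one]

end AAA

/-- Theorem (A(A+A) covers all nonzero residues): for every `α > 1/8` there is a
threshold `p₀` such that for every prime `p ≥ p₀` and every `A ⊆ ZMod p` with
`|A| ≥ α·p`, every nonzero `x` can be written as `a * (b + c)` with `a b c ∈ A`. -/
theorem a_mul_a_add_a_covers :
    ∀ α : ℝ, α > 1 / 8 →
      ∃ p₀ : ℕ, ∀ p : ℕ, p.Prime → p ≥ p₀ →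
        ∀ A : Finset (ZMod p), α * p ≤ (A.card : ℝ) →
          ∀ x : ZMod p, x ≠ 0 → ∃ a ∈ A, ∃ b ∈ A, ∃ c ∈ A, x = a * (b + c) := by
  intro α hα
  set η : ℝ := min (α - 1 / 8) 1 / 10 with hηdef
  have hmpos : 0 < min (α - 1 / 8) 1 := lt_min (by linarith) one_pos
  have hη : 0 < η := by positivity
  have hη1 : η ≤ 1 := by
    have := min_le_right (α - 1 / 8) 1
    rw [hηdef]; linarith
  have hηα : 10 * η ≤ α - 1 / 8 := by
    have := min_le_left (α - 1 / 8) 1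
    rw [hηdef]; linarith
  clear_value η
  have hδ : 0 < (η ^ 5 / 3) / 2 := by positivity
  obtain ⟨N, hN⟩ := exists_nat_gt (2 * Real.pi / ((η ^ 5 / 3) / 2))
  have hN0 : (0 : ℝ) < N := lt_trans (by have := Real.pi_pos; positivity) hN
  have hNδ : 2 * Real.pi / N ≤ (η ^ 5 / 3) / 2 := by
    rw [div_lt_iff₀ hδ] at hN
    rw [div_le_iff₀ hN0]; linarith
  obtain ⟨M, hM⟩ := exists_nat_gt (1 / ((η ^ 5 / 3) / 2) ^ 2)
  rw [div_lt_iff₀ (by positivity)] at hM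
  obtain ⟨p₁, hp₁⟩ := AAA.eventually_small η hη N M
  obtain ⟨p₂, hp₂⟩ := exists_nat_gt (1 / η)
  rw [div_lt_iff₀ hη] at hp₂
  refine ⟨max p₁ p₂, fun p hp hpge A hA x hx => ?_⟩
  have : Fact p.Prime := ⟨hp⟩
  have hp' : (0 : ℝ) < p := by exact_mod_cast hp.pos
  have hpη : 1 ≤ η * p := by
    have : (p₂ : ℝ) ≤ p := by exact_mod_cast (le_max_right p₁ p₂).trans hpge
    nlinarith
  by_contra! hcon
  have hmain := AAA.main_fixed (p := p) hη hη1 (by exact_mod_cast hN0) hNδ hM hpη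
    (hp₁ p ((le_max_left _ _).trans hpge)) (A.erase 0) (notMem_erase _ _) x hx
    (fun a ha b hb c hc => hcon a (mem_of_mem_erase ha) b (mem_of_mem_erase hb) c
      (mem_of_mem_erase hc))
  have hcard : (A.card : ℝ) ≤ (A.erase 0).card + 1 := by
    have : A.card ≤ (A.erase 0).card + 1 := by
      have := pred_card_le_card_erase (s := A) (a := 0)
      omega
    exact_mod_cast this
  nlinarith
end

section
/- There exists an absolute constant C > 0 such that for every sufficiently large prime p and every set A ⊆ (ZMod p) \ {0} with |A| = α·p and α ≥ C·(log log p)^{2/3}/(log p)^{1/3}, one has |A + A*| > min(2·√(|A|·p), p) − C·p·(log log p)^{1/3}/(log p)^{1/6}, where A* := {a⁻¹ : a ∈ A}. -/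
open Finset
open scoped Classical Pointwise
noncomputable section

/-- Set of multiplicative inverses. -/
def inv' {p : ℕ} (A : Finset (ZMod p)) : Finset (ZMod p) := A.image (fun x => x⁻¹)

/-- representation count -/
def rp {p : ℕ} (A B : Finset (ZMod p)) (x : ZMod p) : ℕ := #(A.filter (fun a => x - a ∈ B))

lemma rp_sum {p : ℕ} [Fact p.Prime] (A B : Finset (ZMod p)) : ∑ x, rp A B x = #A * #B := by
  unfold rp
  simp_rw [card_filter]
  rw [sum_comm]
  rw [← smul_eq_mul, ← sum_const]
  refine sum_congr rfl fun a _ => ?_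
  rw [← Equiv.sum_comp (Equiv.addRight a)]
  simp

lemma rp_le {p : ℕ} (A B : Finset (ZMod p)) (x : ZMod p) : rp A B x ≤ #A := card_filter_le _ _

lemma rp_comm {p : ℕ} (A B : Finset (ZMod p)) (x : ZMod p) : rp A B x = rp B A x := by
  unfold rp
  refine card_bij' (fun a _ => x - a) (fun a _ => x - a) ?_ ?_ ?_ ?_ <;> simp <;> tauto

lemma rp_mono {p : ℕ} {A B A' B' : Finset (ZMod p)} (hA : A ⊆ A') (hB : B ⊆ B') (x : ZMod p) :
    rp A B x ≤ rp A' B' x := by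
  unfold rp
  apply card_le_card
  intro a
  simp only [mem_filter]
  exact fun h => ⟨hA h.1, hB h.2⟩

lemma rp_transform {p : ℕ} (A B : Finset (ZMod p)) (x : ZMod p) :
    rp A B x = rp (A ∩ B) (A ∪ B) x + rp (A \ B) (B \ A) x := by
  have h2 : rp (A ∩ B) (A ∪ B) x = rp (A ∩ B) B x + rp (A ∩ B) (A \ B) x := by
    unfold rp
    rw [← card_union_of_disjoint, ← filter_or]
    · congr 1
      ext a
      simp only [mem_filter, mem_union, mem_sdiff]
      tauto
    · rw [disjoint_filter]
      intro a _ h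
      simp [h]
  have h3 : rp A B x = rp (A ∩ B) B x + rp (A \ B) B x := by
    unfold rp
    rw [← card_union_of_disjoint, ← filter_union]
    · rw [union_comm, sdiff_union_inter]
    · exact disjoint_filter_filter (disjoint_sdiff_inter A B).symm
  have h4 : rp (A \ B) B x = rp (A \ B) (A ∩ B) x + rp (A \ B) (B \ A) x := by
    unfold rp
    rw [← card_union_of_disjoint, ← filter_or]
    · congr 1
      ext a
      simp only [mem_filter, mem_inter, mem_sdiff]
      tauto
    · rw [disjoint_filter]
      intro a _ h
      simp only [mem_inter, mem_sdiff] at *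
      tauto
  have h5 := rp_comm (A \ B) (A ∩ B) x
  omega

lemma exists_shift {p : ℕ} [Fact p.Prime] (A B : Finset (ZMod p)) (hA : A.Nonempty)
    (hA' : A ≠ univ) (hB : 1 < #B) :
    ∃ c : ZMod p, (A ∩ B.image (· + c)).Nonempty ∧ #(A ∩ B.image (· + c)) < #B := by
  by_contra! h
  obtain ⟨b, hb, b', hb', hne⟩ := one_lt_card.1 hB
  have step : ∀ a ∈ A, a + (b' - b) ∈ A := by
    intro a ha
    have h1 := h (a - b) ⟨a, mem_inter.2 ⟨ha, mem_image.2 ⟨b, hb, by ring⟩⟩⟩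
    have h2 : #(B.image (· + (a-b))) ≤ #(A ∩ B.image (· + (a-b))) := card_image_le.trans h1
    have h3 := eq_of_subset_of_card_le (inter_subset_right) h2
    have : b' + (a - b) ∈ A ∩ B.image (· + (a-b)) := by
      rw [h3]; exact mem_image_of_mem _ hb'
    have := (mem_inter.1 this).1
    convert this using 1; ring
  obtain ⟨a, ha⟩ := hA
  have st2 : ∀ n : ℕ, a + n * (b' - b) ∈ A := by
    intro n
    induction n with
    | zero => simpa
    | succ n ih => convert step _ ih using 1; push_cast; ring
  apply hA'
  ext y
  simp only [mem_univ, iff_true]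
  have hd : b' - b ≠ 0 := sub_ne_zero.2 hne.symm
  have := st2 ((y - a) / (b' - b)).val
  rw [ZMod.natCast_zmod_val] at this
  convert this using 1
  field_simp
  ring

lemma rp_shift {p : ℕ} (A B : Finset (ZMod p)) (c x : ZMod p) :
    rp A (B.image (· + c)) (x + c) = rp A B x := by
  unfold rp
  congr 1
  ext a
  simp only [mem_filter, mem_image]
  refine and_congr_right fun _ => ⟨?_, fun h => ⟨_, h, by ring⟩⟩
  rintro ⟨b, hb, e⟩
  have : x - a = b := by linear_combination -e
  rwa [this]

/-- Pollard's theorem -/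
lemma pollard_aux {p : ℕ} [Fact p.Prime] (m : ℕ) : ∀ (A B : Finset (ZMod p)) (t : ℕ), #B ≤ m → 1 ≤ t →
    t ≤ #B → #B ≤ #A → #A + #B ≤ p + t → t * (#A + #B - t) ≤ ∑ x, min t (rp A B x) := by
  induction m with
  | zero => intro A B t h1 h2 h3; omega
  | succ m ih =>
    intro A B t hm ht htB hBA hp
    rcases eq_or_lt_of_le htB with e | hlt
    · have : ∀ x, min t (rp A B x) = rp A B x := by
        intro x; rw [min_eq_right]; rw [rp_comm, e]; exact rp_le _ _ _
      simp_rw [this, rp_sum, e]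
      simp [mul_comm]
    · have hA' : A ≠ univ := by
        rintro rfl
        simp [ZMod.card] at hp; omega
      obtain ⟨c, hc1, hc2⟩ := exists_shift A B (card_pos.1 (by omega)) hA' (by omega)
      set B' := B.image (· + c) with hB'
      have hcard : #B' = #B := card_image_of_injective _ (add_left_injective c)
      have hsum : ∑ x, min t (rp A B x) = ∑ x, min t (rp A B' x) := by
        rw [← Equiv.sum_comp (Equiv.addRight c) (fun x => min t (rp A B' x))]
        exact sum_congr rfl fun x _ => by rw [Equiv.coe_addRight, hB', rp_shift]
      rw [hsum, ← hcard]
      rw [← hcard] at hc2 hBA hlt hm hp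
      have hi := card_pos.2 hc1
      have hu := card_union_add_card_inter A B'
      have hd1 := card_sdiff_add_card_inter A B'
      have hd2 := card_sdiff_add_card_inter B' A
      rw [inter_comm B' A] at hd2
      by_cases hit : t ≤ #(A ∩ B')
      · have h1 := ih (A ∪ B') (A ∩ B') t (by omega) ht hit (by omega) (by omega)
        rw [hu] at h1
        refine h1.trans (sum_le_sum fun x _ => min_le_min_left _ ?_)
        rw [rp_transform A B' x, rp_comm (A ∩ B')]
        omega
      · push Not at hit
        have h1 := ih (A \ B') (B' \ A) (t - #(A ∩ B')) (by omega) (by omega) (by omega) (by omega) (by omega)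
        have h2 := rp_sum (A ∩ B') (A ∪ B')
        have h3 : ∑ x, rp (A ∩ B') (A ∪ B') x + ∑ x, min (t - #(A ∩ B')) (rp (A \ B') (B' \ A) x)
            ≤ ∑ x, min t (rp A B' x) := by
          rw [← sum_add_distrib]
          refine sum_le_sum fun x _ => ?_
          rw [rp_transform A B' x]
          have := rp_le (A ∩ B') (A ∪ B') x
          omega
        refine le_trans ?_ h3
        rw [h2]
        refine le_trans ?_ (Nat.add_le_add_left h1 _)
        generalize #(A ∩ B') = i at *
        obtain ⟨j, rfl⟩ := Nat.exists_eq_add_of_lt hit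
        obtain ⟨w, hw⟩ := Nat.exists_eq_add_of_lt hlt
        have e1 : #(A \ B') + #(B' \ A) - (i + j + 1 - i) = #A + w + 1 - i := by omega
        have e2 : #A + #B' - (i+j+1) = #A + w + 1 := by omega
        have e4 : #(A ∪ B') = #A + #B' - i := by omega
        have e5 : i + j + 1 - i = j + 1 := by omega
        rw [e1, e2, e4, e5, hw]
        obtain ⟨q, hq⟩ := Nat.exists_eq_add_of_le (show i ≤ #A by omega)
        have e6 : #A + (i + j + 1 + w + 1) - i = i + q + j + w + 2 := by omega
        have e7 : #A + w + 1 - i = q + w + 1 := by omega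
        rw [e6, e7, hq]
        apply le_of_eq
        ring


/-- Popular sums: the consequence of Pollard's theorem we need. -/
lemma popular {p : ℕ} [Fact p.Prime] (A B : Finset (ZMod p)) (t : ℕ) (s : ℝ) (ht : 1 ≤ t)
    (hs : 0 ≤ s) (htA : t ≤ #A) (htB : t ≤ #B) :
    (t : ℝ) * min (p : ℝ) (#A + #B - t) ≤
      t * #(univ.filter fun x => s ≤ (rp A B x : ℝ)) + s * p := by
  wlog hBA : #B ≤ #A generalizing A B
  · have := this B A htB htA (by omega)
    simp_rw [rp_comm B A] at this
    rwa [add_comm (#B : ℝ)] at this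
  have key : (t : ℝ) * min (p : ℝ) (#A + #B - t) ≤ ((∑ x, min t (rp A B x) : ℕ) : ℝ) := by
    have hpA : #A ≤ p := by simpa [ZMod.card] using card_le_univ A
    rcases le_total (#A + #B) (p + t) with h | h
    · have h1 := pollard_aux _ A B t le_rfl ht htB hBA h
      have h2 : ((t * (#A + #B - t) : ℕ) : ℝ) = t * (#A + #B - t) := by
        rw [Nat.cast_mul, Nat.cast_sub (by omega), Nat.cast_add]
      calc _ ≤ (t : ℝ) * (#A + #B - t) := by gcongr; exact min_le_right _ _
        _ ≤ _ := by rw [← h2]; exact_mod_cast h1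
    · obtain ⟨B', hB', hc⟩ := exists_subset_card_eq (show p + t - #A ≤ #B by omega)
      have h1 := pollard_aux _ A B' t le_rfl ht (by omega) (by omega) (by omega)
      rw [hc, show #A + (p + t - #A) - t = p by omega] at h1
      calc _ ≤ (t : ℝ) * p := by gcongr; exact min_le_left _ _
        _ ≤ ((∑ x, min t (rp A B' x) : ℕ) : ℝ) := by exact_mod_cast h1
        _ ≤ _ := by
          exact_mod_cast sum_le_sum fun x _ => min_le_min_left _ (rp_mono (Subset.refl A) hB' x)
  refine key.trans ?_
  push_cast
  have : ∀ x : ZMod p, min (t : ℝ) (rp A B x) ≤ (if s ≤ (rp A B x : ℝ) then (t : ℝ) else 0) + s := by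
    intro x
    split_ifs with h
    · have := min_le_left (t : ℝ) (rp A B x); linarith
    · have := min_le_right (t : ℝ) (rp A B x); linarith
  refine (sum_le_sum fun x _ => this x).trans ?_
  rw [sum_add_distrib, ← sum_filter, sum_const, sum_const]
  simp [ZMod.card, mul_comm]

/-- Kloosterman sum -/
noncomputable def kl (p : ℕ) [Fact p.Prime] (s t : ZMod p) : ℂ :=
  ∑ u : (ZMod p)ˣ, ZMod.stdAddChar (s * (u : ZMod p) + t * ((u⁻¹ : (ZMod p)ˣ) : ZMod p))

/-- exponential sum over a set -/
noncomputable def es {p : ℕ} [Fact p.Prime] (X : Finset (ZMod p)) (s : ZMod p) : ℂ :=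
  ∑ x ∈ X, ZMod.stdAddChar (s * x)

lemma char_sum {p : ℕ} [Fact p.Prime] (b : ZMod p) :
    ∑ s : ZMod p, (ZMod.stdAddChar (s * b) : ℂ) = if b = 0 then (p : ℂ) else 0 := by
  rw [AddChar.sum_mulShift b (ZMod.isPrimitive_stdAddChar p)]
  simp [ZMod.card]

lemma char_sum2 {p : ℕ} [Fact p.Prime] (b c : ZMod p) :
    ∑ s : ZMod p, ∑ t : ZMod p, (ZMod.stdAddChar (s * b + t * c) : ℂ) =
      if b = 0 ∧ c = 0 then (p : ℂ) ^ 2 else 0 := by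
  simp_rw [AddChar.map_add_eq_mul, ← mul_sum, ← sum_mul, char_sum]
  split_ifs <;> simp_all [sq]

lemma char_conj {p : ℕ} [Fact p.Prime] (b : ZMod p) :
    (starRingEnd ℂ) (ZMod.stdAddChar b : ℂ) = ZMod.stdAddChar (-b) :=
  (AddChar.map_neg_eq_conj _ _).symm

lemma parseval1 {p : ℕ} [Fact p.Prime] (X : Finset (ZMod p)) :
    ∑ s : ZMod p, ‖es X s‖ ^ 2 = p * #X := by
  have : ((∑ s : ZMod p, ‖es X s‖ ^ 2 : ℝ) : ℂ) = ((p * #X : ℝ) : ℂ) := by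
    push_cast
    simp_rw [← Complex.mul_conj', es, map_sum, char_conj, sum_mul_sum, ← AddChar.map_add_eq_mul]
    rw [sum_comm]
    simp_rw [sum_comm (s := univ) (t := X), ← mul_neg, ← mul_add, char_sum]
    have : ∀ x ∈ X, ∑ y ∈ X, (if x + -y = 0 then (p : ℂ) else 0) = p := by
      intro x hx
      simp_rw [← sub_eq_add_neg, sub_eq_zero]
      simp [hx]
    rw [sum_congr rfl this]
    simp [mul_comm]
  exact_mod_cast this

lemma parseval2 {p : ℕ} [Fact p.Prime] {ι : Type*} [Fintype ι] (f g : ι → ZMod p) :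
    ∑ s : ZMod p, ∑ t : ZMod p, ‖∑ i, (ZMod.stdAddChar (s * f i + t * g i) : ℂ)‖ ^ 2 =
      p ^ 2 * #(univ.filter fun ij : ι × ι => f ij.1 = f ij.2 ∧ g ij.1 = g ij.2) := by
  have : ((∑ s : ZMod p, ∑ t : ZMod p, ‖∑ i, (ZMod.stdAddChar (s * f i + t * g i) : ℂ)‖ ^ 2 : ℝ) : ℂ)
      = ((p ^ 2 * #(univ.filter fun ij : ι × ι => f ij.1 = f ij.2 ∧ g ij.1 = g ij.2) : ℝ) : ℂ) := by
    push_cast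
    simp_rw [← Complex.mul_conj', map_sum, char_conj, sum_mul_sum, ← AddChar.map_add_eq_mul]
    have e0 : ∀ F : ZMod p → ZMod p → ι → ι → ℂ, ∑ s, ∑ t, ∑ i, ∑ j, F s t i j =
        ∑ ij : ι × ι, ∑ st : ZMod p × ZMod p, F st.1 st.2 ij.1 ij.2 := by
      intro F
      simp_rw [Fintype.sum_prod_type, sum_comm (s := (univ : Finset (ZMod p))) (t := (univ : Finset ι))]
    rw [e0]
    have : ∀ ij : ι × ι, ∑ st : ZMod p × ZMod p, (ZMod.stdAddChar (st.1 * f ij.1 + st.2 * g ij.1 +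
        -(st.1 * f ij.2 + st.2 * g ij.2)) : ℂ) =
        if f ij.1 = f ij.2 ∧ g ij.1 = g ij.2 then (p : ℂ) ^ 2 else 0 := by
      intro ij
      have h := char_sum2 (f ij.1 - f ij.2) (g ij.1 - g ij.2)
      rw [← sum_product', univ_product_univ] at h
      simp_rw [sub_eq_zero] at h
      rw [← h]
      refine sum_congr rfl fun st _ => ?_
      congr 1
      ring
    rw [sum_congr rfl fun ij _ => this ij, ← sum_filter, sum_const]
    simp [mul_comm]
  exact_mod_cast this

lemma kl_fourth {p : ℕ} [Fact p.Prime] :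
    ∑ s : ZMod p, ∑ t : ZMod p, ‖kl p s t‖ ^ 4 ≤ 3 * p ^ 2 * ((p : ℝ) - 1) ^ 2 := by
  have h := parseval2 (p := p) (fun u : (ZMod p)ˣ × (ZMod p)ˣ => (u.1 : ZMod p) + (u.2 : ZMod p))
    (fun u => ((u.1⁻¹ : (ZMod p)ˣ) : ZMod p) + ((u.2⁻¹ : (ZMod p)ˣ) : ZMod p))
  have e : ∀ s t : ZMod p, ‖kl p s t‖ ^ 4 = ‖∑ u : (ZMod p)ˣ × (ZMod p)ˣ, (ZMod.stdAddChar
      (s * ((u.1 : ZMod p) + (u.2 : ZMod p)) + t * (((u.1⁻¹ : (ZMod p)ˣ) : ZMod p) + ((u.2⁻¹ : (ZMod p)ˣ) : ZMod p))) : ℂ)‖ ^ 2 := by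
    intro s t
    rw [show 4 = 2 * 2 by rfl, pow_mul, ← norm_pow, sq (kl p s t), kl, sum_mul_sum, ← univ_product_univ, sum_product]
    simp_rw [← AddChar.map_add_eq_mul]
    congr 2
    refine sum_congr rfl fun u _ => sum_congr rfl fun v _ => ?_
    congr 1
    ring
  simp_rw [e, h]
  have hp1 : (1 : ℕ) ≤ p := (Fact.out : p.Prime).one_le
  have hc : Fintype.card (ZMod p)ˣ = p - 1 := ZMod.card_units p
  rw [mul_comm 3, mul_assoc]
  refine mul_le_mul_of_nonneg_left ?_ (by positivity)
  rw [show ((p : ℝ) - 1) = ((p - 1 : ℕ) : ℝ) by rw [Nat.cast_sub hp1]; simp]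
  norm_cast
  let f1 : (ZMod p)ˣ × (ZMod p)ˣ → ((ZMod p)ˣ × (ZMod p)ˣ) × ((ZMod p)ˣ × (ZMod p)ˣ) := fun u => ((u.1, -u.1), (u.2, -u.2))
  let f2 : (ZMod p)ˣ × (ZMod p)ˣ → ((ZMod p)ˣ × (ZMod p)ˣ) × ((ZMod p)ˣ × (ZMod p)ˣ) := fun u => ((u.1, u.2), (u.1, u.2))
  let f3 : (ZMod p)ˣ × (ZMod p)ˣ → ((ZMod p)ˣ × (ZMod p)ˣ) × ((ZMod p)ˣ × (ZMod p)ˣ) := fun u => ((u.1, u.2), (u.2, u.1))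
  have hsub : (univ.filter fun ij : ((ZMod p)ˣ × (ZMod p)ˣ) × ((ZMod p)ˣ × (ZMod p)ˣ) => (ij.1.1 : ZMod p) + ij.1.2 = ij.2.1 + ij.2.2 ∧
      ((ij.1.1⁻¹ : (ZMod p)ˣ) : ZMod p) + (ij.1.2⁻¹ : (ZMod p)ˣ) = (ij.2.1⁻¹ : (ZMod p)ˣ) + (ij.2.2⁻¹ : (ZMod p)ˣ)) ⊆
      univ.image f1 ∪ univ.image f2 ∪ univ.image f3 := by
    rintro ⟨⟨a, b⟩, ⟨c, d⟩⟩ hx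
    simp only [mem_filter, mem_univ, true_and] at hx
    obtain ⟨h1, h2⟩ := hx
    simp only [mem_union, mem_image, mem_univ, true_and, f1, f2, f3, Prod.mk.injEq]
    have ha := a.ne_zero
    have hb := b.ne_zero
    have hc := c.ne_zero
    have hd := d.ne_zero
    by_cases h0 : (a : ZMod p) + b = 0
    · left; left
      refine ⟨(a, c), ⟨rfl, ?_⟩, rfl, ?_⟩
      · ext; push_cast; linear_combination -h0
      · ext; push_cast; linear_combination h1 - h0
    · simp only [Units.val_inv_eq_inv_val] at h2
      field_simp at h2
      have h3 : (c : ZMod p) * d = a * b := by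
        apply mul_left_cancel₀ h0
        rw [show (a : ZMod p) + b = b + a by ring] at h0 ⊢
        rw [show (d : ZMod p) + c = a + b by rw [h1]; ring] at h2
        linear_combination h2
      have h4 : ((a : ZMod p) - c) * (a - d) = 0 := by linear_combination a * h1 + h3
      rcases mul_eq_zero.1 h4 with h5 | h5
      · left; right
        refine ⟨(a, b), ⟨rfl, rfl⟩, ?_, ?_⟩
        · ext; linear_combination h5
        · ext; linear_combination h1 - h5
      · right
        refine ⟨(a, b), ⟨rfl, rfl⟩, ?_, ?_⟩
        · ext; linear_combination h1 - h5
        · ext; linear_combination h5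
  refine (card_le_card hsub).trans ?_
  have hi : ∀ f : (ZMod p)ˣ × (ZMod p)ˣ → ((ZMod p)ˣ × (ZMod p)ˣ) × ((ZMod p)ˣ × (ZMod p)ˣ), #(univ.image f) ≤ (p - 1) ^ 2 := by
    intro f
    refine card_image_le.trans ?_
    simp [hc, sq]
  have h1 := card_union_le (univ.image f1 ∪ univ.image f2) (univ.image f3)
  have h2 := card_union_le (univ.image f1) (univ.image f2)
  have := hi f1
  have := hi f2
  have := hi f3
  omega

lemma kl_bound {p : ℕ} [Fact p.Prime] (s t : ZMod p) (h : (s, t) ≠ (0, 0)) :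
    ‖kl p s t‖ ≤ 2 * (p : ℝ) ^ ((3 : ℝ) / 4) := by
  have hp2 : (2 : ℝ) ≤ p := by exact_mod_cast (Fact.out : p.Prime).two_le
  have hinv : ∀ v : (ZMod p)ˣ, kl p (s * v) (t * (v⁻¹ : (ZMod p)ˣ)) = kl p s t := by
    intro v
    unfold kl
    rw [← Equiv.sum_comp (Equiv.mulLeft v) (fun u : (ZMod p)ˣ => (ZMod.stdAddChar (s * (u : ZMod p) + t * ((u⁻¹ : (ZMod p)ˣ) : ZMod p)) : ℂ))]
    refine sum_congr rfl fun u _ => ?_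
    simp only [Equiv.coe_mulLeft, mul_inv, Units.val_mul]
    congr 1
    ring
  have h1 : ((p : ℝ) - 1) * ‖kl p s t‖ ^ 4 ≤ ∑ s : ZMod p, ∑ t : ZMod p, ‖kl p s t‖ ^ 4 := by
    rw [← sum_product', univ_product_univ]
    have hinj : Function.Injective (fun v : (ZMod p)ˣ => (s * (v : ZMod p), t * ((v⁻¹ : (ZMod p)ˣ) : ZMod p))) := by
      intro v w hvw
      simp only [Prod.mk.injEq] at hvw
      by_cases hs : s = 0
      · have ht : t ≠ 0 := by rintro rfl; exact h (by rw [hs])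
        exact inv_injective (Units.ext (mul_left_cancel₀ ht hvw.2))
      · exact Units.ext (mul_left_cancel₀ hs hvw.1)
    calc _ = ∑ v : (ZMod p)ˣ, ‖kl p (s * v) (t * (v⁻¹ : (ZMod p)ˣ))‖ ^ 4 := by
          simp_rw [hinv]
          rw [sum_const, card_univ, ZMod.card_units p, nsmul_eq_mul, Nat.cast_sub (Fact.out : p.Prime).one_le]
          simp
      _ = ∑ x ∈ univ.image (fun v : (ZMod p)ˣ => (s * (v : ZMod p), t * ((v⁻¹ : (ZMod p)ˣ) : ZMod p))), ‖kl p x.1 x.2‖ ^ 4 := by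
          rw [sum_image (fun _ _ _ _ h => hinj h)]
      _ ≤ _ := sum_le_sum_of_subset_of_nonneg (subset_univ _) fun _ _ _ => by positivity
  have h2 := h1.trans kl_fourth
  have h3 : ‖kl p s t‖ ^ 4 ≤ 3 * p ^ 2 * ((p : ℝ) - 1) := by
    have : 0 < (p : ℝ) - 1 := by linarith
    apply le_of_mul_le_mul_left _ this
    linarith
  have h4 : ‖kl p s t‖ ^ 4 ≤ (2 * (p : ℝ) ^ ((3 : ℝ) / 4)) ^ 4 := by
    rw [mul_pow, ← Real.rpow_natCast ((p : ℝ) ^ ((3 : ℝ) / 4)) 4, ← Real.rpow_mul (by positivity)]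
    norm_num
    nlinarith [sq_nonneg (p : ℝ)]
  exact le_of_pow_le_pow_left₀ (by norm_num) (by positivity) h4

/-- The number of triples of a unit and two shifts landing in X and Y. -/
noncomputable def qcount {p : ℕ} [Fact p.Prime] (X Y T : Finset (ZMod p)) : ℕ :=
  ∑ u : (ZMod p)ˣ, #(T.filter fun t => (u : ZMod p) + t ∈ X) *
    #(T.filter fun t => ((u⁻¹ : (ZMod p)ˣ) : ZMod p) - t ∈ Y)

lemma count1 {p : ℕ} [Fact p.Prime] (X T : Finset (ZMod p)) (a : ZMod p) :
    (p : ℂ) * #(T.filter fun t => a + t ∈ X) =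
      ∑ s : ZMod p, ZMod.stdAddChar (s * a) * (es T s * (starRingEnd ℂ) (es X s)) := by
  simp_rw [es, map_sum, char_conj, sum_mul_sum, mul_sum, ← AddChar.map_add_eq_mul]
  rw [sum_comm]
  simp_rw [sum_comm (s := univ) (t := X)]
  have : ∀ t ∈ T, ∑ x ∈ X, ∑ s : ZMod p, (ZMod.stdAddChar (s * a + (s * t + -(s * x))) : ℂ) =
      if a + t ∈ X then (p : ℂ) else 0 := by
    intro t _
    have : ∀ x, ∑ s : ZMod p, (ZMod.stdAddChar (s * a + (s * t + -(s * x))) : ℂ) = if a + t = x then (p : ℂ) else 0 := by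
      intro x
      have h := char_sum (a + t - x)
      simp_rw [sub_eq_zero] at h
      rw [← h]
      refine sum_congr rfl fun s _ => ?_
      congr 1; ring
    simp_rw [this]
    simp
  rw [sum_congr rfl this, ← sum_filter, sum_const]
  simp [mul_comm]

lemma count2 {p : ℕ} [Fact p.Prime] (Y T : Finset (ZMod p)) (a : ZMod p) :
    (p : ℂ) * #(T.filter fun t => a - t ∈ Y) =
      ∑ s : ZMod p, ZMod.stdAddChar (s * a) * ((starRingEnd ℂ) (es T s) * (starRingEnd ℂ) (es Y s)) := by
  have h := count1 Y (T.image (fun t => -t)) a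
  have e1 : #((T.image (fun t => -t)).filter fun t => a + t ∈ Y) = #(T.filter fun t => a - t ∈ Y) := by
    rw [filter_image, card_image_of_injective _ neg_injective]
    simp [sub_eq_add_neg]
  have e2 : ∀ s, es (T.image (fun t => -t)) s = (starRingEnd ℂ) (es T s) := by
    intro s
    simp only [es]
    rw [sum_image (fun _ _ _ _ h => neg_injective h), map_sum]
    simp [char_conj]
  simp_rw [e1, e2] at h
  exact h

lemma es_zero {p : ℕ} [Fact p.Prime] (X : Finset (ZMod p)) : es X 0 = #X := by simp [es]

lemma es_l1 {p : ℕ} [Fact p.Prime] (X T : Finset (ZMod p)) :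
    ∑ s : ZMod p, ‖es T s‖ * ‖es X s‖ ≤ p * Real.sqrt (p * #T) := by
  have h := Real.sum_mul_le_sqrt_mul_sqrt univ (fun s : ZMod p => ‖es T s‖) (fun s => ‖es X s‖)
  rw [parseval1, parseval1] at h
  have hX : (#X : ℝ) ≤ p := by
    have := card_le_univ X
    rw [ZMod.card] at this
    exact_mod_cast this
  have h2 : Real.sqrt (p * #X) ≤ p := by
    rw [Real.sqrt_le_left (by positivity)]
    nlinarith [Nat.cast_nonneg (α := ℝ) p]
  nlinarith [Real.sqrt_nonneg ((p : ℝ) * #T)]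

lemma qcount_le {p : ℕ} [Fact p.Prime] (X Y T : Finset (ZMod p)) :
    (qcount X Y T : ℝ) ≤ #X * #Y * #T ^ 2 / p + 2 * (p : ℝ) ^ ((3 : ℝ) / 4) * p * #T := by
  have hp0 : (0 : ℝ) < p := by exact_mod_cast (Fact.out : p.Prime).pos
  set a : ZMod p → ℂ := fun s => es T s * (starRingEnd ℂ) (es X s) with ha
  set b : ZMod p → ℂ := fun s => (starRingEnd ℂ) (es T s) * (starRingEnd ℂ) (es Y s) with hb
  have h1 : (p : ℂ) ^ 2 * qcount X Y T = ∑ st : ZMod p × ZMod p, kl p st.1 st.2 * (a st.1 * b st.2) := by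
    rw [qcount, Nat.cast_sum, mul_sum]
    simp_rw [Nat.cast_mul]
    have : ∀ u : (ZMod p)ˣ, (p : ℂ) ^ 2 * (#(T.filter fun t => (u : ZMod p) + t ∈ X) *
      #(T.filter fun t => ((u⁻¹ : (ZMod p)ˣ) : ZMod p) - t ∈ Y)) =
       ∑ st : ZMod p × ZMod p, ZMod.stdAddChar (st.1 * (u : ZMod p) + st.2 * ((u⁻¹ : (ZMod p)ˣ) : ZMod p)) * (a st.1 * b st.2) := by
      intro u
      rw [show ∀ x y : ℂ, (p : ℂ) ^ 2 * (x * y) = (p * x) * (p * y) by intros; ring, count1, count2, sum_mul_sum,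
        ← sum_product', univ_product_univ]
      refine sum_congr rfl fun st _ => ?_
      rw [AddChar.map_add_eq_mul]
      ring
    rw [sum_congr rfl fun u _ => this u, sum_comm]
    refine sum_congr rfl fun st _ => ?_
    rw [kl, sum_mul]
  have hk0 : kl p 0 0 = (p : ℂ) - 1 := by
    simp only [kl, zero_mul, add_zero, AddChar.map_zero_eq_one, sum_const, card_univ, ZMod.card_units p, nsmul_eq_mul, mul_one]
    rw [Nat.cast_sub (Fact.out : p.Prime).one_le, Nat.cast_one]
  rw [← add_sum_erase _ _ (mem_univ ((0 : ZMod p), (0 : ZMod p)))] at h1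
  have h2 : (p : ℝ) ^ 2 * qcount X Y T ≤ p * (#T * #X * (#T * #Y)) +
      2 * (p : ℝ) ^ ((3 : ℝ) / 4) * ((p * Real.sqrt (p * #T)) * (p * Real.sqrt (p * #T))) := by
    have e1 : (p : ℝ) ^ 2 * qcount X Y T = ‖(p : ℂ) ^ 2 * qcount X Y T‖ := by simp
    rw [e1, h1]
    refine (norm_add_le _ _).trans (add_le_add ?_ ?_)
    · simp only [hk0, ha, hb, es_zero, norm_mul, map_natCast, Complex.norm_natCast]
      gcongr
      have : ‖(p : ℂ) - 1‖ = p - 1 := by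
        have : (p : ℂ) - 1 = ((p - 1 : ℝ) : ℂ) := by push_cast; rfl
        rw [this, Complex.norm_real, Real.norm_of_nonneg]
        have : (1 : ℝ) ≤ p := by exact_mod_cast (Fact.out : p.Prime).one_le
        linarith
      rw [this]; linarith
    · refine (norm_sum_le _ _).trans ?_
      calc _ ≤ ∑ st ∈ univ.erase ((0 : ZMod p), (0 : ZMod p)), 2 * (p : ℝ) ^ ((3 : ℝ) / 4) * (‖a st.1‖ * ‖b st.2‖) := by
            refine sum_le_sum fun st hst => ?_
            rw [norm_mul, norm_mul]
            gcongr
            exact kl_bound _ _ (ne_of_mem_erase hst)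
        _ ≤ ∑ st : ZMod p × ZMod p, 2 * (p : ℝ) ^ ((3 : ℝ) / 4) * (‖a st.1‖ * ‖b st.2‖) :=
            sum_le_sum_of_subset_of_nonneg (subset_univ _) fun _ _ _ => by positivity
        _ = 2 * (p : ℝ) ^ ((3 : ℝ) / 4) * ((∑ s, ‖a s‖) * ∑ s, ‖b s‖) := by
            rw [← mul_sum, sum_mul_sum, ← sum_product', univ_product_univ]
        _ ≤ _ := by
            have e2 := es_l1 X T
            have e3 := es_l1 Y T
            have e4 : ∑ s, ‖a s‖ ≤ p * Real.sqrt (p * #T) := by simpa [ha] using e2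
            have e5 : ∑ s, ‖b s‖ ≤ p * Real.sqrt (p * #T) := by simpa [hb] using e3
            gcongr
  have hsq : Real.sqrt (p * #T) * Real.sqrt (p * #T) = p * #T := Real.mul_self_sqrt (by positivity)
  apply le_of_mul_le_mul_left _ (show (0 : ℝ) < p ^ 2 by positivity)
  refine h2.trans (le_of_eq ?_)
  rw [show ((p : ℝ) * Real.sqrt (p * #T)) * (p * Real.sqrt (p * #T)) = p ^ 2 * (Real.sqrt (p * #T) * Real.sqrt (p * #T)) by ring, hsq]
  field_simp
lemma sampling {p : ℕ} [Fact p.Prime] (A B : Finset (ZMod p)) (θ : ℝ) (k : ℕ) (h0 : 0 < θ) (_h1 : θ ≤ 1)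
    (hk : (1 - θ) ^ k ≤ θ / 2) :
    ∃ T : Finset (ZMod p), (#A : ℝ) ^ k * p ≤ 2 * #T * p ^ k ∧ ∀ t ∈ T, ∀ t' ∈ T,
      (#(univ.filter fun x : ZMod p => θ * #A ≤ rp A B x ∧ x - t + t' ∉ A + B) : ℝ) ≤ θ * p := by
  have hp0 : (0 : ℝ) < p := by exact_mod_cast (Fact.out : p.Prime).pos
  set Ω : Finset (Fin k → ZMod p) := Fintype.piFinset (fun _ => A) with hΩ
  have hΩc : #Ω = #A ^ k := by simp [hΩ]
  set bad : (Fin k → ZMod p) → Finset (ZMod p) := fun a =>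
    univ.filter fun x => θ * #A ≤ rp A B x ∧ ∀ i, x - a i ∉ B with hbad
  have hsum : ∑ a ∈ Ω, (#(bad a) : ℝ) ≤ p * (#A ^ k * (θ / 2)) := by
    have e1 : ∑ a ∈ Ω, (#(bad a) : ℝ) = ∑ x : ZMod p,
        (#(Ω.filter fun a => θ * #A ≤ rp A B x ∧ ∀ i, x - a i ∉ B) : ℝ) := by
      simp only [hbad, card_filter]
      push_cast
      exact sum_comm
    rw [e1]
    have e2 : ∀ x : ZMod p, (#(Ω.filter fun a => θ * #A ≤ rp A B x ∧ ∀ i, x - a i ∉ B) : ℝ) ≤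
        #A ^ k * (θ / 2) := by
      intro x
      by_cases hx : θ * #A ≤ rp A B x
      · have e3 : (Ω.filter fun a => θ * #A ≤ rp A B x ∧ ∀ i, x - a i ∉ B) =
            Fintype.piFinset (fun _ : Fin k => A.filter fun a => x - a ∉ B) := by
          ext a
          simp only [hΩ, mem_filter, Fintype.mem_piFinset, hx, true_and]
          exact ⟨fun h i => ⟨h.1 i, h.2 i⟩, fun h => ⟨fun i => (h i).1, fun i => (h i).2⟩⟩
        rw [e3]
        simp only [Fintype.card_piFinset, prod_const, card_univ, Fintype.card_fin]
        have e4 : (#(A.filter fun a => x - a ∉ B) : ℝ) ≤ #A * (1 - θ) := by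
          have := card_filter_add_card_filter_not (s := A) (fun a => x - a ∈ B)
          have : (rp A B x : ℝ) + #(A.filter fun a => x - a ∉ B) = #A := by
            rw [rp]; exact_mod_cast this
          linarith
        push_cast
        calc _ ≤ (#A * (1 - θ)) ^ k := by gcongr
          _ = #A ^ k * (1 - θ) ^ k := by rw [mul_pow]
          _ ≤ _ := by gcongr
      · simp [hx]; positivity
    refine (sum_le_sum fun x _ => e2 x).trans ?_
    simp [ZMod.card]
  set Good := Ω.filter fun a => (#(bad a) : ℝ) ≤ θ * p with hGood
  have hgood : (#A : ℝ) ^ k ≤ 2 * #Good := by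
    have e1 := card_filter_add_card_filter_not (s := Ω) (fun a => (#(bad a) : ℝ) ≤ θ * p)
    have e2 : (#(Ω.filter fun a => ¬ (#(bad a) : ℝ) ≤ θ * p) : ℝ) * (θ * p) ≤ ∑ a ∈ Ω, (#(bad a) : ℝ) := by
      calc _ = ∑ a ∈ Ω.filter fun a => ¬ (#(bad a) : ℝ) ≤ θ * p, θ * p := by simp
        _ ≤ ∑ a ∈ Ω.filter fun a => ¬ (#(bad a) : ℝ) ≤ θ * p, (#(bad a) : ℝ) :=
            sum_le_sum fun a ha => (not_le.1 (mem_filter.1 ha).2).le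
        _ ≤ _ := sum_le_sum_of_subset_of_nonneg (filter_subset _ _) fun _ _ _ => by positivity
    have e3 : (#(Ω.filter fun a => ¬ (#(bad a) : ℝ) ≤ θ * p) : ℝ) ≤ #A ^ k / 2 := by
      have : 0 < θ * p := by positivity
      apply le_of_mul_le_mul_right _ this
      linarith
    have e4 : (#Good : ℝ) + #(Ω.filter fun a => ¬ (#(bad a) : ℝ) ≤ θ * p) = #A ^ k := by
      rw [← Nat.cast_pow, ← hΩc]; exact_mod_cast e1
    linarith
  have hpig : ∃ c : Fin k → ZMod p, (#Good : ℝ) * p ≤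
      #(univ.filter fun t : ZMod p => (fun i => c i + t) ∈ Good) * p ^ k := by
    by_contra! hcon
    have e1 : ∑ c : Fin k → ZMod p, #(univ.filter fun t : ZMod p => (fun i => c i + t) ∈ Good) = #Good * p := by
      simp only [card_filter]
      rw [sum_comm]
      have : ∀ t : ZMod p, ∑ c : Fin k → ZMod p, (if (fun i => c i + t) ∈ Good then 1 else 0) = #Good := by
        intro t
        have := Equiv.sum_comp (Equiv.addRight (fun _ : Fin k => t)) (fun c => if c ∈ Good then 1 else 0)
        have e : ∀ c : Fin k → ZMod p, (Equiv.addRight (fun _ : Fin k => t)) c = fun i => c i + t := fun c => rfl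
        simp_rw [e] at this
        rw [this]
        simp
      simp_rw [this]
      simp [ZMod.card, mul_comm]
    have e2 : ∑ c : Fin k → ZMod p, (#(univ.filter fun t : ZMod p => (fun i => c i + t) ∈ Good) : ℝ) * p ^ k <
        ∑ c : Fin k → ZMod p, (#Good : ℝ) * p :=
      sum_lt_sum_of_nonempty univ_nonempty fun c _ => hcon c
    rw [← sum_mul, sum_const, card_univ, Fintype.card_fun, ZMod.card, Fintype.card_fin, nsmul_eq_mul,
      ← Nat.cast_sum, e1] at e2
    push_cast at e2
    linarith
  obtain ⟨c, hc⟩ := hpig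
  refine ⟨univ.filter fun t : ZMod p => (fun i => c i + t) ∈ Good, ?_, ?_⟩
  · nlinarith
  · intro t ht t' ht'
    simp only [mem_filter, mem_univ, true_and] at ht ht'
    refine le_trans ?_ (mem_filter.1 ht).2
    norm_cast
    apply card_le_card
    intro x hx
    simp only [mem_filter, mem_univ, true_and, hbad] at hx ⊢
    refine ⟨hx.1, fun i hi => hx.2 ?_⟩
    have hA : c i + t' ∈ A := by
      have := (mem_filter.1 ht').1
      rw [hΩ, Fintype.mem_piFinset] at this
      exact this i
    have := add_mem_add hA hi
    convert this using 1
    ring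

/-- smoothing count -/
def sm {p : ℕ} (A T : Finset (ZMod p)) (σ : ZMod p → ZMod p) (x : ZMod p) : ℕ :=
  #(T.filter fun t => x - σ t ∈ A)

lemma sm_swap {p : ℕ} [Fact p.Prime] (A T X : Finset (ZMod p)) (σ : ZMod p → ZMod p) :
    ∑ a ∈ A, #(T.filter fun t => a + σ t ∉ X) = ∑ x ∈ Xᶜ, sm A T σ x := by
  simp only [sm, card_filter]
  rw [sum_comm, sum_comm (s := Xᶜ)]
  refine sum_congr rfl fun t _ => ?_
  simp only [← card_filter]
  refine card_bij' (fun a _ => a + σ t) (fun a _ => a - σ t) ?_ ?_ ?_ ?_ <;> simp <;> tauto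

lemma sm_conv {p : ℕ} [Fact p.Prime] (A B T : Finset (ZMod p)) (z : ZMod p) :
    ∑ x, sm A T id x * sm B T Neg.neg (z - x) = ∑ t ∈ T, ∑ t' ∈ T, rp A B (z - t + t') := by
  simp only [sm, card_filter, sum_mul_sum]
  rw [sum_comm]
  refine sum_congr rfl fun t _ => ?_
  rw [sum_comm]
  refine sum_congr rfl fun t' _ => ?_
  rw [← Equiv.sum_comp (Equiv.addRight t), rp, card_filter, ← sum_filter_add_sum_filter_not univ (fun x => x ∈ A)]
  have e : (univ.filter fun x => x ∈ A) = A := by ext; simp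
  rw [e, add_eq_left.2]
  · refine sum_congr rfl fun a ha => ?_
    have : z - (a + t) - -t' = z - t + t' - a := by ring
    simp [ha, this]
  · refine sum_eq_zero fun x hx => ?_
    simp only [mem_filter, mem_univ, true_and] at hx
    simp [hx]

lemma conv_off {p : ℕ} [Fact p.Prime] (A B T : Finset (ZMod p)) (θ : ℝ) (h0 : 0 < θ)
    (hT : ∀ t ∈ T, ∀ t' ∈ T,
      (#(univ.filter fun x : ZMod p => θ * #A ≤ rp A B x ∧ x - t + t' ∉ A + B) : ℝ) ≤ θ * p) :
    ∑ z ∈ (A + B)ᶜ, ∑ x, (sm A T id x : ℝ) * sm B T Neg.neg (z - x) ≤ 2 * θ * #A * p * #T ^ 2 := by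
  have e1 : ∀ z, ∑ x, (sm A T id x : ℝ) * sm B T Neg.neg (z - x) =
      ∑ t ∈ T, ∑ t' ∈ T, (rp A B (z - t + t') : ℝ) := fun z => by exact_mod_cast sm_conv A B T z
  simp_rw [e1]
  rw [sum_comm]
  simp_rw [sum_comm (s := (A + B)ᶜ)]
  have e2 : ∀ t ∈ T, ∀ t' ∈ T, ∑ z ∈ (A + B)ᶜ, (rp A B (z - t + t') : ℝ) ≤ 2 * θ * #A * p := by
    intro t ht t' ht'
    have e3 : ∀ z ∈ (A + B)ᶜ, (rp A B (z - t + t') : ℝ) ≤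
        θ * #A + #A * (if θ * #A ≤ rp A B (z - t + t') then 1 else 0) := by
      intro z _
      have h1 : (rp A B (z - t + t') : ℝ) ≤ #A := by exact_mod_cast rp_le _ _ _
      have h2 : 0 ≤ θ * (#A : ℝ) := by positivity
      split_ifs with h
      · linarith
      · linarith
    refine (sum_le_sum e3).trans ?_
    rw [sum_add_distrib, sum_const, ← mul_sum, ← sum_filter, sum_const, nsmul_eq_mul, nsmul_eq_mul, mul_one]
    have e4 : (#((A + B)ᶜ) : ℝ) ≤ p := by
      have := card_le_univ ((A + B)ᶜ)
      rw [ZMod.card] at this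
      exact_mod_cast this
    have e5 : (#((A + B)ᶜ.filter fun z => θ * #A ≤ rp A B (z - t + t')) : ℝ) ≤ θ * p := by
      refine le_trans ?_ (hT t' ht' t ht)
      norm_cast
      refine card_le_card_of_injOn (fun z => z - t + t') ?_ ?_
      · intro z hz
        simp only [coe_filter, mem_compl, Set.mem_ofPred_eq, mem_univ, true_and] at hz ⊢
        refine ⟨hz.2, ?_⟩
        rw [show z - t + t' - t' + t = z by ring]
        exact hz.1
      · intro z _ w _ h
        simpa using h
    have : 0 ≤ θ * (#A : ℝ) := by positivity
    have h3 : 0 ≤ (#A : ℝ) := by positivity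
    nlinarith
  calc _ ≤ ∑ t ∈ T, ∑ t' ∈ T, 2 * θ * #A * p := sum_le_sum fun t ht => sum_le_sum fun t' ht' => e2 t ht t' ht'
    _ = _ := by simp; ring

lemma pop_off {p : ℕ} [Fact p.Prime] (A B T X Y : Finset (ZMod p)) (θ δ s : ℝ) (h0 : 0 < θ) (hδ : 0 ≤ δ)
    (hT0 : T.Nonempty)
    (hX : ∀ x ∈ X, δ * #T ≤ sm A T id x) (hY : ∀ y ∈ Y, δ * #T ≤ sm B T Neg.neg y)
    (hT : ∀ t ∈ T, ∀ t' ∈ T,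
      (#(univ.filter fun x : ZMod p => θ * #A ≤ rp A B x ∧ x - t + t' ∉ A + B) : ℝ) ≤ θ * p) :
    (#((univ.filter fun x => s ≤ (rp X Y x : ℝ)) \ (A + B)) : ℝ) * (s * δ ^ 2) ≤ 2 * θ * #A * p := by
  have hTp : (0 : ℝ) < #T := by exact_mod_cast hT0.card_pos
  have h1 := conv_off A B T θ h0 hT
  have h2 : ∀ z, (rp X Y z : ℝ) * (δ * #T) ^ 2 ≤ ∑ x, (sm A T id x : ℝ) * sm B T Neg.neg (z - x) := by
    intro z
    calc _ = ∑ x ∈ X.filter (fun x => z - x ∈ Y), (δ * #T) ^ 2 := by simp [rp]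
      _ ≤ ∑ x ∈ X.filter (fun x => z - x ∈ Y), (sm A T id x : ℝ) * sm B T Neg.neg (z - x) := by
          refine sum_le_sum fun x hx => ?_
          rw [mem_filter] at hx
          rw [sq]
          exact mul_le_mul (hX x hx.1) (hY _ hx.2) (by positivity) (by positivity)
      _ ≤ _ := sum_le_sum_of_subset_of_nonneg (subset_univ _) fun _ _ _ => by positivity
  have h3 : (#((univ.filter fun x => s ≤ (rp X Y x : ℝ)) \ (A + B)) : ℝ) * (s * (δ * #T) ^ 2) ≤
      ∑ z ∈ (A + B)ᶜ, ∑ x, (sm A T id x : ℝ) * sm B T Neg.neg (z - x) := by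
    calc _ = ∑ z ∈ (univ.filter fun x => s ≤ (rp X Y x : ℝ)) \ (A + B), (s * (δ * #T) ^ 2) := by simp
      _ ≤ ∑ z ∈ (univ.filter fun x => s ≤ (rp X Y x : ℝ)) \ (A + B),
            ∑ x, (sm A T id x : ℝ) * sm B T Neg.neg (z - x) := by
          refine sum_le_sum fun z hz => le_trans ?_ (h2 z)
          simp only [mem_sdiff, mem_filter, mem_univ, true_and] at hz
          gcongr
          exact hz.1
      _ ≤ _ := sum_le_sum_of_subset_of_nonneg (by intro z; simp) fun _ _ _ => sum_nonneg fun _ _ => by positivity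
  have : (0 : ℝ) < #T ^ 2 := by positivity
  apply le_of_mul_le_mul_right _ this
  calc _ = _ := by ring
    _ ≤ _ := h3
    _ ≤ _ := h1

lemma mass {p : ℕ} [Fact p.Prime] (A T X Y : Finset (ZMod p)) (δ : ℝ) (hA0 : (0 : ZMod p) ∉ A)
    (hδ : 0 ≤ δ)
    (hX : ∀ x ∉ X, (sm A T id x : ℝ) ≤ δ * #T) (hY : ∀ y ∉ Y, (sm (inv' A) T Neg.neg y : ℝ) ≤ δ * #T) :
    (#A : ℝ) * #T ^ 2 ≤ qcount X Y T + 2 * δ * #T ^ 2 * p := by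
  have hc : ∀ Z : Finset (ZMod p), (#Z : ℝ) ≤ p := by
    intro Z
    have := card_le_univ Z
    rw [ZMod.card] at this
    exact_mod_cast this
  have b1 : ∀ (A' Z : Finset (ZMod p)) (σ : ZMod p → ZMod p), (∀ x ∉ Z, (sm A' T σ x : ℝ) ≤ δ * #T) →
      ∑ a ∈ A', (#(T.filter fun t => a + σ t ∉ Z) : ℝ) ≤ δ * #T * p := by
    intro A' Z σ h
    have := sm_swap A' T Z σ
    have e : ∑ a ∈ A', (#(T.filter fun t => a + σ t ∉ Z) : ℝ) = ∑ x ∈ Zᶜ, (sm A' T σ x : ℝ) := by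
      exact_mod_cast this
    rw [e]
    calc _ ≤ ∑ x ∈ Zᶜ, δ * #T := sum_le_sum fun x hx => h x (mem_compl.1 hx)
      _ = #(Zᶜ) * (δ * #T) := by simp
      _ ≤ p * (δ * #T) := mul_le_mul_of_nonneg_right (hc _) (by positivity)
      _ = _ := by ring
  have b2 := b1 A X id hX
  have b3 := b1 (inv' A) Y Neg.neg hY
  rw [inv', sum_image (fun _ _ _ _ h => inv_injective h)] at b3
  set m : ZMod p → ℝ := fun a => #(T.filter fun t => a + t ∈ X) with hm
  set m' : ZMod p → ℝ := fun a => #(T.filter fun t => a⁻¹ - t ∈ Y) with hm'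
  have c1 : ∀ a, (#(T.filter fun t => a + id t ∉ X) : ℝ) = #T - m a := by
    intro a
    have := card_filter_add_card_filter_not (s := T) (fun t => a + t ∈ X)
    have : m a + (#(T.filter fun t => a + t ∉ X) : ℝ) = #T := by simp only [hm]; exact_mod_cast this
    simp only [id]; linarith
  have c2 : ∀ a : ZMod p, (#(T.filter fun t => a⁻¹ + -t ∉ Y) : ℝ) = #T - m' a := by
    intro a
    have := card_filter_add_card_filter_not (s := T) (fun t => a⁻¹ - t ∈ Y)
    have : m' a + (#(T.filter fun t => a⁻¹ - t ∉ Y) : ℝ) = #T := by simp only [hm']; exact_mod_cast this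
    simp only [← sub_eq_add_neg]; linarith
  simp_rw [c1] at b2
  simp_rw [c2] at b3
  have c3 : ∀ a, m a ≤ #T := fun a => by simp only [hm]; exact_mod_cast card_filter_le _ _
  have c4 : ∀ a, m' a ≤ #T := fun a => by simp only [hm']; exact_mod_cast card_filter_le _ _
  have d1 : ∑ a ∈ A, m a * m' a ≤ qcount X Y T := by
    have e1 : (qcount X Y T : ℝ) = ∑ u : (ZMod p)ˣ, m u * m' u := by
      simp only [qcount, hm, hm', Nat.cast_sum, Nat.cast_mul, Units.val_inv_eq_inv_val]
    rw [e1, ← sum_image (s := (univ : Finset (ZMod p)ˣ)) (g := fun u : (ZMod p)ˣ => (u : ZMod p)) (f := fun a => m a * m' a)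
      (fun _ _ _ _ h => Units.ext h)]
    refine sum_le_sum_of_subset_of_nonneg ?_ fun _ _ _ => by positivity
    intro a ha
    have : a ≠ 0 := by rintro rfl; exact hA0 ha
    exact mem_image.2 ⟨Units.mk0 a this, mem_univ _, rfl⟩
  have d2 : ∀ a ∈ A, (#T : ℝ) ^ 2 ≤ m a * m' a + #T * (#T - m a) + #T * (#T - m' a) := by
    intro a _
    nlinarith [mul_nonneg (sub_nonneg.2 (c3 a)) (sub_nonneg.2 (c4 a))]
  have d3 := sum_le_sum d2
  rw [sum_add_distrib, sum_add_distrib, ← mul_sum, ← mul_sum, sum_const, nsmul_eq_mul] at d3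
  have hTp : (0 : ℝ) ≤ #T := by positivity
  nlinarith [mul_le_mul_of_nonneg_left b2 hTp, mul_le_mul_of_nonneg_left b3 hTp]

lemma finite_main {p : ℕ} [Fact p.Prime] (A : Finset (ZMod p)) (hA0 : (0 : ZMod p) ∉ A)
    (κ w : ℝ) (k : ℕ) (hκ0 : 0 < κ) (hκ1 : κ ≤ 1) (hw : 6 * κ ≤ w) (hA : (#A : ℝ) = w ^ 2 * p)
    (hk : (1 - κ ^ 6) ^ k ≤ κ ^ 6 / 2) (hp : 4 ≤ κ * w * (p : ℝ) ^ ((1 : ℝ) / 4) * (w ^ 2) ^ k)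
    (hκp : 1 ≤ κ * p) :
    min (2 * w * p) p - 11 * κ * p ≤ #(A + inv' A) := by
  have hp0 : (0 : ℝ) < p := by exact_mod_cast (Fact.out : p.Prime).pos
  have hw0 : 0 < w := by linarith
  have hc : ∀ Z : Finset (ZMod p), (#Z : ℝ) ≤ p := by
    intro Z
    have := card_le_univ Z
    rw [ZMod.card] at this
    exact_mod_cast this
  obtain ⟨T, hT1, hT2⟩ := sampling A (inv' A) (κ ^ 6) k (by positivity) (pow_le_one₀ hκ0.le hκ1) hk
  set δ := κ * w with hδ
  have hδ0 : 0 < δ := by positivity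
  have hT3 : (w ^ 2) ^ k * p ≤ 2 * #T := by
    rw [hA, mul_pow] at hT1
    apply le_of_mul_le_mul_right _ (show (0 : ℝ) < p ^ k by positivity)
    linarith
  have hTp : (0 : ℝ) < #T := by
    have : 0 < (w ^ 2) ^ k * p := by positivity
    linarith
  have hT0 : T.Nonempty := card_pos.1 (by exact_mod_cast hTp)
  have hpp : (p : ℝ) ^ ((3 : ℝ) / 4) * (p : ℝ) ^ ((1 : ℝ) / 4) = p := by
    rw [← Real.rpow_add hp0]; norm_num
  have hT4 : 2 * (p : ℝ) ^ ((3 : ℝ) / 4) ≤ δ * #T := by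
    have h1 : 4 * (p : ℝ) ^ ((3 : ℝ) / 4) ≤ (p : ℝ) ^ ((3 : ℝ) / 4) * (δ * (p : ℝ) ^ ((1 : ℝ) / 4) * (w ^ 2) ^ k) := by
      rw [mul_comm]; gcongr
    have h2 : (p : ℝ) ^ ((3 : ℝ) / 4) * (δ * (p : ℝ) ^ ((1 : ℝ) / 4) * (w ^ 2) ^ k) = δ * ((w ^ 2) ^ k * p) := by
      rw [← hpp]
      rw [hpp]
      linear_combination δ * (w ^ 2) ^ k * hpp
    have h3 := mul_le_mul_of_nonneg_left hT3 hδ0.le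
    linarith
  obtain ⟨X, hX⟩ : ∃ X : Finset (ZMod p), ∀ x, x ∈ X ↔ δ * #T ≤ (sm A T id x : ℝ) :=
    ⟨univ.filter fun x => δ * #T ≤ (sm A T id x : ℝ), by simp⟩
  obtain ⟨Y, hY⟩ : ∃ Y : Finset (ZMod p), ∀ x, x ∈ Y ↔ δ * #T ≤ (sm (inv' A) T Neg.neg x : ℝ) :=
    ⟨univ.filter fun x => δ * #T ≤ (sm (inv' A) T Neg.neg x : ℝ), by simp⟩
  set S := A + inv' A with hS
  have hmass := mass A T X Y δ hA0 hδ0.le (fun x hx => (not_le.1 (mt (hX x).2 hx)).le)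
    (fun x hx => (not_le.1 (mt (hY x).2 hx)).le)
  have hoff := pop_off A (inv' A) T X Y (κ ^ 6) δ (κ ^ 3 * p) (by positivity) hδ0.le hT0
    (fun x hx => (hX x).1 hx) (fun x hx => (hY x).1 hx) hT2
  have hq := qcount_le X Y T
  have hXc := hc X
  have hYc := hc Y
  -- product bound
  have hex : ∀ Z : Finset (ZMod p), ∃ z : ℝ, (#Z : ℝ) = z * p ∧ 0 ≤ z ∧ z ≤ 1 := by
    intro Z
    refine ⟨#Z / p, by field_simp, div_nonneg (Nat.cast_nonneg _) hp0.le, ?_⟩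
    rw [div_le_one hp0]
    exact hc Z
  obtain ⟨x, hXx, hx0, hx1⟩ := hex X
  obtain ⟨y, hYy, hy0, hy1⟩ := hex Y
  have hxy : w ^ 2 - 3 * κ * w ≤ x * y := by
    have h1 : (#X : ℝ) * #Y * #T ^ 2 / p = x * y * (#T ^ 2 * p) := by
      rw [hXx, hYy]; field_simp
    rw [h1] at hq
    rw [hA] at hmass
    have h2 : 2 * (p : ℝ) ^ ((3 : ℝ) / 4) * p * #T ≤ δ * (#T ^ 2 * p) := by
      calc _ = 2 * (p : ℝ) ^ ((3 : ℝ) / 4) * (p * #T) := by ring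
        _ ≤ δ * #T * (p * #T) := by gcongr
        _ = _ := by ring
    apply le_of_mul_le_mul_right _ (show (0 : ℝ) < #T ^ 2 * p by positivity)
    have h3 : 3 * κ * w = 3 * δ := by rw [hδ]; ring
    rw [h3]
    linarith
  have hκw : 0 ≤ κ * (w - 6 * κ) := mul_nonneg hκ0.le (by linarith)
  have hww : 0 ≤ w * (w - 6 * κ) := mul_nonneg hw0.le (by linarith)
  have hκκ : 0 ≤ κ ^ 2 := by positivity
  have hxy2 : w ^ 2 / 2 ≤ x * y := by linarith
  have hsum : 2 * (w - 3 * κ) ≤ x + y := by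
    apply le_of_sq_le_sq _ (by positivity)
    have := sq_nonneg (x - y)
    linarith
  have hκw2 : κ ^ 2 ≤ w ^ 2 / 2 := by linarith
  have hxl : κ ^ 2 ≤ x := by
    have := mul_le_mul_of_nonneg_left hy1 hx0
    linarith
  have hyl : κ ^ 2 ≤ y := by
    have := mul_le_mul_of_nonneg_right hx1 hy0
    linarith
  -- choose t
  set t : ℕ := min ⌈κ * p⌉₊ (min #X #Y) with ht
  have ht1 : κ ^ 2 * p ≤ t := by
    rw [ht, Nat.cast_min, Nat.cast_min]
    refine le_min ?_ (le_min ?_ ?_)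
    · refine le_trans ?_ (Nat.le_ceil _)
      gcongr
      simpa using pow_le_pow_of_le_one hκ0.le hκ1 (show 1 ≤ 2 by norm_num)
    · rw [hXx]; gcongr
    · rw [hYy]; gcongr
  have ht2 : (t : ℝ) ≤ κ * p + 1 := by
    have h1 : (t : ℝ) ≤ ⌈κ * p⌉₊ := by exact_mod_cast min_le_left _ _
    have h2 := Nat.ceil_lt_add_one (show 0 ≤ κ * p by positivity)
    linarith
  have ht0 : (0 : ℝ) < t := lt_of_lt_of_le (by positivity) ht1
  have hpop := popular X Y t (κ ^ 3 * p) (by exact_mod_cast ht0) (by positivity)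
    ((min_le_right _ _).trans (min_le_left _ _)) ((min_le_right _ _).trans (min_le_right _ _))
  set D := univ.filter fun x => κ ^ 3 * p ≤ (rp X Y x : ℝ) with hD
  have hD1 : min (p : ℝ) (#X + #Y - t) ≤ #D + κ * p := by
    apply le_of_mul_le_mul_left _ ht0
    have : κ ^ 3 * p * p ≤ t * (κ * p) := by
      calc _ = κ ^ 2 * p * (κ * p) := by ring
        _ ≤ _ := by gcongr
    linarith
  have hD2 : (#(D \ S) : ℝ) ≤ 2 * κ * p := by
    apply le_of_mul_le_mul_right _ (show 0 < κ ^ 3 * p * δ ^ 2 by positivity)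
    refine hoff.trans (le_of_eq ?_)
    rw [hA, hδ]; ring
  have hD3 : (#D : ℝ) ≤ #S + #(D \ S) := by
    have := card_le_card_sdiff_add_card (s := D) (t := S)
    rw [add_comm]
    exact_mod_cast this
  have hfin : min (2 * w * p) p ≤ min (p : ℝ) (#X + #Y - t) + 8 * κ * p := by
    rw [← min_add_add_right]
    refine le_min ?_ ?_
    · refine (min_le_right _ _).trans ?_
      linarith
    · refine (min_le_left _ _).trans ?_
      rw [hXx, hYy]
      have := mul_le_mul_of_nonneg_right hsum hp0.le
      linarith
  linarith

lemma params (ℓ lam κ : ℝ) (P : ℝ) (hP : 0 < P) (hℓ : Real.log P = ℓ) (hlam : Real.log ℓ = lam)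
    (h1 : 1 ≤ lam) (h2 : 64 * lam ^ 2 ≤ ℓ) (h3 : 10 * lam ≤ ℓ) (h4 : 100 ≤ ℓ) (hκ0 : 0 < κ)
    (hκ : κ ^ 6 = 64 * lam ^ 2 / ℓ) :
    κ ≤ 1 ∧ 1 ≤ κ * P ∧ ∃ k : ℕ, (1 - κ ^ 6) ^ k ≤ κ ^ 6 / 2 ∧
      ∀ w : ℝ, 6 * κ ≤ w → 4 ≤ κ * w * P ^ ((1 : ℝ) / 4) * (w ^ 2) ^ k := by
  have hℓ0 : 0 < ℓ := by linarith
  have hκ6 : κ ^ 6 ≤ 1 := by rw [hκ, div_le_one hℓ0]; exact h2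
  have hκ1 : κ ≤ 1 := by
    by_contra! h
    have := one_lt_pow₀ h (show 6 ≠ 0 by norm_num)
    linarith
  have hlow : 64 / ℓ ≤ κ ^ 6 := by
    rw [hκ]; gcongr; nlinarith
  have hκk : κ ^ 6 ≤ κ := by
    simpa using pow_le_pow_of_le_one hκ0.le hκ1 (show 1 ≤ 6 by norm_num)
  have hPℓ : ℓ ≤ P := by
    have := Real.log_le_sub_one_of_pos hP
    linarith
  refine ⟨hκ1, ?_, ?_⟩
  · calc (1 : ℝ) ≤ 64 / ℓ * ℓ := by field_simp; norm_num
      _ ≤ κ * P := by gcongr; linarith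
  have hl64 : Real.log 64 = 6 * Real.log 2 := by
    rw [show (64 : ℝ) = 2 ^ 6 by norm_num, Real.log_pow]; norm_num
  have hl2 : 0 < Real.log 2 := Real.log_pos (by norm_num)
  have hl2' : Real.log 2 < 1 := by have := Real.log_two_lt_d9; linarith
  have hlogκ : 6 * Real.log κ ≥ Real.log 64 - lam := by
    have := Real.log_le_log (by positivity) hlow
    rw [Real.log_pow, Real.log_div (by norm_num) hℓ0.ne', hlam] at this
    push_cast at this
    linarith
  have hκ6p : 0 < κ ^ 6 := by positivity
  refine ⟨⌈(κ ^ 6)⁻¹ * Real.log (2 / κ ^ 6)⌉₊, ?_, ?_⟩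
  · set k := ⌈(κ ^ 6)⁻¹ * Real.log (2 / κ ^ 6)⌉₊ with hk
    have hk1 : (κ ^ 6)⁻¹ * Real.log (2 / κ ^ 6) ≤ k := Nat.le_ceil _
    have hk2 : Real.log (2 / κ ^ 6) ≤ k * κ ^ 6 := by
      rw [inv_mul_le_iff₀ hκ6p] at hk1; linarith
    calc (1 - κ ^ 6) ^ k ≤ (Real.exp (-κ ^ 6)) ^ k := by
          refine pow_le_pow_left₀ (by linarith) ?_ k
          have := Real.add_one_le_exp (-κ ^ 6); linarith
      _ = Real.exp (-(k * κ ^ 6)) := by rw [← Real.exp_nat_mul]; congr 1; ring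
      _ ≤ Real.exp (-Real.log (2 / κ ^ 6)) := by gcongr
      _ = _ := by rw [Real.exp_neg, Real.exp_log (by positivity)]; rw [inv_div]
  · intro w hw
    set k := ⌈(κ ^ 6)⁻¹ * Real.log (2 / κ ^ 6)⌉₊ with hk
    have hlog2 : Real.log (2 / κ ^ 6) = Real.log 2 - 6 * Real.log κ := by
      rw [Real.log_div (by norm_num) hκ6p.ne', Real.log_pow]; norm_num
    have hlk : Real.log κ ≤ 0 := Real.log_nonpos hκ0.le hκ1
    have hk2 : (k : ℝ) ≤ ℓ / (64 * lam) + 1 := by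
      have h5 : (κ ^ 6)⁻¹ * Real.log (2 / κ ^ 6) ≤ ℓ / (64 * lam) := by
        calc _ ≤ (κ ^ 6)⁻¹ * lam := by gcongr; rw [hlog2]; linarith
          _ = _ := by rw [hκ]; field_simp
      have h6 := Nat.ceil_lt_add_one (show 0 ≤ (κ ^ 6)⁻¹ * Real.log (2 / κ ^ 6) by
        rw [hlog2]; have : 0 ≤ Real.log 2 - 6 * Real.log κ := by linarith
        positivity)
      linarith
    have hwκ : κ ≤ w := by linarith
    calc (4 : ℝ) ≤ κ * κ * P ^ ((1 : ℝ) / 4) * (κ ^ 2) ^ k := by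
          rw [← Real.log_le_log_iff (by norm_num) (by positivity)]
          rw [Real.log_mul (by positivity) (by positivity), Real.log_mul (by positivity) (by positivity),
            Real.log_mul (by positivity) (by positivity), Real.log_rpow hP, hℓ, ← pow_mul, Real.log_pow]
          rw [show (4 : ℝ) = 2 ^ 2 by norm_num, Real.log_pow]
          push_cast
          have h7 : (2 * (k : ℝ) + 2) * (-Real.log κ) ≤ (2 * (ℓ / (64 * lam) + 1) + 2) * (lam / 6) := by
            gcongr
            · linarith
            · linarith
          have h8 : (2 * (ℓ / (64 * lam) + 1) + 2) * (lam / 6) = ℓ / 192 + 2 * lam / 3 := by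
            field_simp; ring
          linarith
      _ ≤ _ := by
          have : 0 ≤ w := by linarith
          gcongr

theorem card_add_inv_lower_bound :
    ∃ C : ℝ, C > 0 ∧ ∃ p₀ : ℕ, ∀ (p : ℕ) [Fact p.Prime], p ≥ p₀ →
      ∀ A : Finset (ZMod p), (0 : ZMod p) ∉ A →
        ∀ α : ℝ, (A.card : ℝ) = α * p →
          α ≥ C * (Real.log (Real.log p)) ^ ((2 : ℝ) / 3) / (Real.log p) ^ ((1 : ℝ) / 3) →
            (((A + inv' A).card : ℝ) >
              min (2 * Real.sqrt ((A.card : ℝ) * p)) (p : ℝ)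
                - C * p * (Real.log (Real.log p)) ^ ((1 : ℝ) / 3) / (Real.log p) ^ ((1 : ℝ) / 6)) := by
  refine ⟨24, by norm_num, ?_⟩
  have hev : ∀ᶠ ℓ : ℝ in Filter.atTop, 1 ≤ Real.log ℓ ∧ 64 * Real.log ℓ ^ 2 ≤ ℓ ∧ 10 * Real.log ℓ ≤ ℓ ∧ 100 ≤ ℓ := by
    have e1 := Real.tendsto_log_atTop.eventually_ge_atTop 1
    have e2 := (Real.isLittleO_pow_log_id_atTop (n := 2)).def (show (0 : ℝ) < 1 / 64 by norm_num)
    have e3 := (Real.isLittleO_pow_log_id_atTop (n := 1)).def (show (0 : ℝ) < 1 / 10 by norm_num)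
    filter_upwards [e1, e2, e3, Filter.eventually_ge_atTop 100] with ℓ h1 h2 h3 h4
    simp only [id, norm_pow, Real.norm_eq_abs, pow_one] at h2 h3
    rw [abs_of_nonneg (show 0 ≤ ℓ by linarith), abs_of_nonneg (show 0 ≤ Real.log ℓ by linarith)] at h2 h3
    exact ⟨h1, by linarith, by linarith, h4⟩
  obtain ⟨p₀, hp₀⟩ := Filter.eventually_atTop.1
    ((Real.tendsto_log_atTop.comp tendsto_natCast_atTop_atTop).eventually hev)
  refine ⟨p₀, fun p _ hp A hA0 α hα _ => ?_⟩
  obtain ⟨h1, h2, h3, h4⟩ := hp₀ p hp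
  simp only [Function.comp] at h1 h2 h3 h4
  have hp0 : (0 : ℝ) < p := by exact_mod_cast (Fact.out : p.Prime).pos
  set ℓ := Real.log p with hℓ
  set lam := Real.log ℓ with hlam
  have hℓ0 : 0 < ℓ := by linarith
  have hlam0 : 0 < lam := by linarith
  obtain ⟨κ, hκ⟩ : ∃ κ : ℝ, κ = 2 * (lam ^ ((1 : ℝ) / 3) / ℓ ^ ((1 : ℝ) / 6)) := ⟨_, rfl⟩
  have hκ0 : 0 < κ := by rw [hκ]; positivity
  have hκ6 : κ ^ 6 = 64 * lam ^ 2 / ℓ := by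
    rw [hκ, mul_pow, div_pow, ← Real.rpow_natCast (lam ^ ((1 : ℝ) / 3)) 6, ← Real.rpow_natCast (ℓ ^ ((1 : ℝ) / 6)) 6,
      ← Real.rpow_mul hlam0.le, ← Real.rpow_mul hℓ0.le]
    norm_num
    ring
  have hα0 : 0 ≤ α := by
    have : 0 ≤ α * p := by rw [← hα]; positivity
    exact nonneg_of_mul_nonneg_left this hp0
  have hsq : Real.sqrt ((#A : ℝ) * p) = Real.sqrt α * p := by
    rw [hα, mul_assoc, Real.sqrt_mul hα0, Real.sqrt_mul_self hp0.le]
  have herr : 24 * p * lam ^ ((1 : ℝ) / 3) / ℓ ^ ((1 : ℝ) / 6) = 12 * κ * p := by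
    rw [hκ]; ring
  rw [hsq, herr, ← mul_assoc]
  have hκp0 : 0 < κ * p := by positivity
  rcases le_or_gt (6 * κ) (Real.sqrt α) with hw | hw
  · obtain ⟨hκ1, hκp, k, hk, hk2⟩ := params ℓ lam κ p hp0 rfl rfl h1 h2 h3 h4 hκ0 hκ6
    have := finite_main A hA0 κ (Real.sqrt α) k hκ0 hκ1 hw (by rw [hα, Real.sq_sqrt hα0]) hk (hk2 _ hw) hκp
    linarith
  · have e1 : min (2 * Real.sqrt α * p) (p : ℝ) ≤ 2 * Real.sqrt α * p := min_le_left _ _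
    have e2 : Real.sqrt α * p < 6 * κ * p := by gcongr
    have e3 : (0 : ℝ) ≤ #(A + inv' A) := by positivity
    linarith
end
end
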